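/- arXiv:1406.7518 — 4 statements merged into one kernel-verified Lean document; each statement's English description precedes it below -/
import Mathlib

section
/- There exist a strictly increasing sequence of natural numbers (m_n)_{n≥1} and an atomless (continuous) Borel probability measure μ on the circle ℝ/ℤ such that: (1) for every irrational real number θ, the sequence of fractional parts (m_n θ [1])_{n≥1} is dense in [0,1); (2) for every natural number k ≥ 2, the set {n ∈ ℕ : k does not divide m_n} is infinite; and (3) lim_{n→∞} ∫_{ℝ/ℤ} ‖m_n θ‖ dμ(θ) = 0. -/
open MeasureTheory Filter

/-- Distance from a real number to the nearest integer. -/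
noncomputable def distToInt (x : ℝ) : ℝ := |x - round x|

theorem exists_nsmul_dense {X : Type*} [NormedAddCommGroup X] [CompleteSpace X]
    [SecondCountableTopology X]
    (hdiv : ∀ N : ℕ, 0 < N → ∀ f : X, ∃ g : X, N • g = f ∧ ‖g‖ ≤ 1 / (N : ℝ)) :
    ∃ φ : X, ∀ (M : ℕ) (V : Set X), IsOpen V → V.Nonempty → ∃ m, M ≤ m ∧ m • φ ∈ V := by
  let B := TopologicalSpace.countableBasis X
  have hB : B.Countable := TopologicalSpace.countable_countableBasis X
  have : Countable B := hB.to_subtype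
  let U : ℕ × B → Set X := fun i => ⋃ m ∈ Set.Ici i.1, (fun φ : X => m • φ) ⁻¹' i.2.1
  have hUo : ∀ i, IsOpen (U i) := fun i =>
    isOpen_biUnion fun m _ =>
      (TopologicalSpace.isOpen_of_mem_countableBasis i.2.2).preimage (continuous_nsmul m)
  have hUd : ∀ i, Dense (U i) := by
    rintro ⟨M, V, hV⟩
    obtain ⟨ψ, hψ⟩ := TopologicalSpace.nonempty_of_mem_countableBasis hV
    rw [Metric.dense_iff]
    intro φ₀ r hr
    obtain ⟨n, hn⟩ := exists_nat_one_div_lt hr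
    obtain ⟨g, hg, hgn⟩ := hdiv (max M (n + 1)) (by positivity) (ψ - (max M (n + 1)) • φ₀)
    refine ⟨φ₀ + g, ?_, ?_⟩
    · rw [Metric.mem_ball, dist_eq_norm, add_sub_cancel_left]
      refine (hgn.trans ?_).trans_lt hn
      refine one_div_le_one_div_of_le (by positivity) ?_
      exact_mod_cast le_max_right M (n + 1)
    · refine Set.mem_biUnion (x := max M (n + 1)) (le_max_left M (n + 1)) ?_
      simpa [nsmul_add, hg] using hψ
  obtain ⟨φ, hφ⟩ := (dense_iInter_of_isOpen hUo hUd).nonempty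
  refine ⟨φ, fun M V hV ⟨v, hv⟩ => ?_⟩
  obtain ⟨W, hW, -, hWV⟩ :=
    (TopologicalSpace.isBasis_countableBasis X).exists_subset_of_mem_open hv hV
  have := Set.mem_iInter.1 hφ (M, ⟨W, hW⟩)
  obtain ⟨m, hm, h⟩ := Set.mem_iUnion₂.1 this
  exact ⟨m, hm, hWV h⟩

theorem exists_nsmul_recurrent {X : Type*} [NormedAddCommGroup X] {φ : X}
    (hφ : ∀ (M : ℕ) (V : Set X), IsOpen V → V.Nonempty → ∃ m, M ≤ m ∧ m • φ ∈ V)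
    (θ : UnitAddCircle) (M : ℕ) {ε : ℝ} (hε : 0 < ε) :
    ∃ r : ℕ, M ≤ r ∧ ‖r • θ‖ < ε ∧ ‖r • φ‖ < ε := by
  obtain ⟨n, hn⟩ := exists_nat_one_div_lt hε
  obtain ⟨r, hMr, hr⟩ := hφ M (Metric.ball 0 (ε / (n + 1))) Metric.isOpen_ball
    (Metric.nonempty_ball.2 (by positivity))
  obtain ⟨j, hj, hjr⟩ := AddCircle.exists_norm_nsmul_le (r • θ) n.succ_pos
  obtain ⟨hj1, hj2⟩ := Set.mem_Icc.1 hj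
  refine ⟨j * r, hMr.trans (Nat.le_mul_of_pos_left r hj1), ?_, ?_⟩
  · rw [mul_nsmul']
    refine (hjr.trans ?_).trans_lt hn
    refine one_div_le_one_div_of_le (by positivity) ?_
    push_cast
    linarith
  · rw [mul_nsmul']
    rw [mem_ball_zero_iff] at hr
    have hj3 : (j : ℝ) ≤ n + 1 := by exact_mod_cast hj2
    calc ‖j • r • φ‖ ≤ j * ‖r • φ‖ := norm_nsmul_le
      _ ≤ (n + 1) * ‖r • φ‖ := by gcongr
      _ < (n + 1) * (ε / (n + 1)) := by gcongr
      _ = ε := by field_simp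

theorem dense_or_prod_le {X : Type*} [AddCommGroup X]
    (H : AddSubgroup (UnitAddCircle × X)) (hH : ∀ f, ∃ t, (t, f) ∈ H) (Y : AddSubgroup X)
    (hY : ∀ N : ℕ, 0 < N → ∀ f ∈ Y, ∃ g ∈ Y, N • g = f) :
    Dense {t : UnitAddCircle | ∃ f ∈ Y, (t, f) ∈ H} ∨ ∀ f ∈ Y, (0, f) ∈ H := by
  let P : AddSubgroup UnitAddCircle :=
    (H ⊓ Y.comap (AddMonoidHom.snd _ _)).map (AddMonoidHom.fst _ _)
  have hP : (P : Set UnitAddCircle) = {t : UnitAddCircle | ∃ f ∈ Y, (t, f) ∈ H} := by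
    ext t
    simp [P, and_comm]
  rw [← hP]
  refine or_iff_not_imp_left.2 fun hd f hf => ?_
  rw [AddCircle.dense_addSubgroup_iff_ne_zmultiples] at hd
  push Not at hd
  obtain ⟨a, ha, hPa⟩ := hd
  obtain ⟨g, hg, rfl⟩ := hY _ (Nat.pos_of_ne_zero ha) f hf
  obtain ⟨t, ht⟩ := hH g
  have htP : t ∈ P := by
    rw [← SetLike.mem_coe, hP]
    exact ⟨g, hg, ht⟩
  rw [hPa] at htP
  obtain ⟨j, rfl⟩ := AddSubgroup.mem_zmultiples_iff.1 htP
  have := H.nsmul_mem ht (addOrderOf a)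
  rwa [Prod.smul_mk, smul_comm, addOrderOf_nsmul_eq_zero, smul_zero] at this

theorem exists_nsmul_near {X : Type*} [NormedAddCommGroup X] {φ : X}
    (hφ : ∀ (M : ℕ) (V : Set X), IsOpen V → V.Nonempty → ∃ m, M ≤ m ∧ m • φ ∈ V)
    (hX : ∀ ε : ℝ, 0 < ε → ∀ G : AddSubgroup X,
      (∀ Y : AddSubgroup X, (∀ g ∈ Y, ‖g‖ < ε) →
        (∀ N : ℕ, 0 < N → ∀ f ∈ Y, ∃ g ∈ Y, N • g = f) → Y ≤ G) → G = ⊤)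
    (θ : UnitAddCircle) (k : ℤ) (M : ℕ) {ε : ℝ} (hε : 0 < ε) :
    ∃ m : ℕ, M ≤ m ∧ ‖m • θ - k • θ‖ < ε ∧ ‖m • φ‖ < ε := by
  let H : AddSubgroup (UnitAddCircle × X) :=
    (AddSubgroup.zmultiples (θ, φ)).topologicalClosure
  have hθφ : (θ, φ) ∈ H :=
    AddSubgroup.le_topologicalClosure _ (AddSubgroup.mem_zmultiples _)
  have hH : ∀ f, ∃ t, (t, f) ∈ H := by
    intro f
    have hcl : IsClosed (Prod.snd '' (H : Set (UnitAddCircle × X))) :=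
      isClosedMap_snd_of_compactSpace _ (AddSubgroup.isClosed_topologicalClosure _)
    by_contra hf
    obtain ⟨m, -, hm⟩ := hφ 0 _ hcl.isOpen_compl ⟨f, by simpa using hf⟩
    exact hm ⟨_, H.nsmul_mem hθφ m, rfl⟩
  have key : ∃ t f, (t, f) ∈ H ∧ ‖t - k • θ‖ < ε / 3 ∧ ‖f‖ < ε / 3 := by
    by_cases hd : ∃ Y : AddSubgroup X, (∀ g ∈ Y, ‖g‖ < ε / 3) ∧
        Dense {t : UnitAddCircle | ∃ f ∈ Y, (t, f) ∈ H}
    · obtain ⟨Y, hYs, hYd⟩ := hd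
      obtain ⟨t, ⟨f, hf, htf⟩, ht⟩ := hYd.exists_dist_lt (k • θ) (by positivity : 0 < ε / 3)
      refine ⟨t, f, htf, ?_, hYs f hf⟩
      rwa [dist_comm, dist_eq_norm] at ht
    · have hG : H.comap (AddMonoidHom.inr UnitAddCircle X) = ⊤ := by
        refine hX (ε / 3) (by positivity) _ fun Y hYs hYd f hf => ?_
        refine (dense_or_prod_le H hH Y hYd).resolve_left (fun h => hd ⟨Y, hYs, h⟩) f hf
      have h0 : ((0 : UnitAddCircle), φ) ∈ H := by
        have : φ ∈ H.comap (AddMonoidHom.inr UnitAddCircle X) := hG ▸ AddSubgroup.mem_top φ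
        exact this
      refine ⟨k • θ, 0, ?_, by simpa using hε, by simpa using hε⟩
      simpa using H.zsmul_mem (H.sub_mem hθφ h0) k
  obtain ⟨t, f, htf, ht, hf⟩ := key
  obtain ⟨z, hz, hzd⟩ := Metric.mem_closure_iff.1
    (show (t, f) ∈ closure (AddSubgroup.zmultiples (θ, φ) : Set (UnitAddCircle × X)) from htf)
    (ε / 3) (by positivity)
  obtain ⟨j, rfl⟩ := AddSubgroup.mem_zmultiples_iff.1 hz
  rw [Prod.dist_eq, max_lt_iff, dist_eq_norm, dist_eq_norm] at hzd
  obtain ⟨r, hr, hrθ, hrφ⟩ := exists_nsmul_recurrent hφ θ (M + j.natAbs)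
    (by positivity : 0 < ε / 3)
  obtain ⟨m, hm⟩ : ∃ m : ℕ, (m : ℤ) = r + j := ⟨(r + j).toNat, by omega⟩
  refine ⟨m, by omega, ?_, ?_⟩
  · calc ‖m • θ - k • θ‖ = ‖r • θ + (t - k • θ) - (t - j • θ)‖ := by
          rw [← natCast_zsmul, hm, add_zsmul, natCast_zsmul]; congr 1; abel
      _ ≤ ‖r • θ‖ + ‖t - k • θ‖ + ‖t - j • θ‖ :=
        norm_sub_le_of_le (norm_add_le _ _) le_rfl
      _ < ε := by linarith [show ‖t - j • θ‖ < ε / 3 from hzd.1]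
  · calc ‖m • φ‖ = ‖r • φ + f - (f - j • φ)‖ := by
          rw [← natCast_zsmul, hm, add_zsmul, natCast_zsmul]; congr 1; abel
      _ ≤ ‖r • φ‖ + ‖f‖ + ‖f - j • φ‖ :=
        norm_sub_le_of_le (norm_add_le _ _) le_rfl
      _ < ε := by linarith [show ‖f - j • φ‖ < ε / 3 from hzd.2]

theorem exists_measurable_div {N : ℕ} (hN : 0 < N) :
    ∃ h : UnitAddCircle → UnitAddCircle, Measurable h ∧ (∀ t, N • h t = t) ∧
      (∀ t, ‖h t‖ ≤ 1 / (N : ℝ)) ∧ h 0 = 0 := by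
  have hN' : (0 : ℝ) < N := by exact_mod_cast hN
  let e := AddCircle.measurableEquivIco (1 : ℝ) 0
  have he : ∀ t, ((e t : ℝ) : UnitAddCircle) = t := fun t => e.symm_apply_apply t
  refine ⟨fun t => (((e t : ℝ) / N : ℝ) : UnitAddCircle), ?_, fun t => ?_, fun t => ?_, ?_⟩
  · exact AddCircle.measurable_mk'.comp ((measurable_subtype_coe.comp e.measurable).div_const _)
  · rw [← AddCircle.coe_nsmul, nsmul_eq_mul, mul_div_cancel₀ _ hN'.ne', he]
  · obtain ⟨h0, h1⟩ := (e t).2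
    refine (QuotientAddGroup.norm_mk_le_norm).trans ?_
    rw [Real.norm_eq_abs, abs_of_nonneg (div_nonneg h0 hN'.le)]
    gcongr
    linarith
  · have : (e 0 : ℝ) = 0 := by
      have h := e.apply_symm_apply ⟨0, by simp⟩
      have h2 : e.symm ⟨0, by simp⟩ = 0 := rfl
      rw [h2] at h
      rw [h]
    simp [this]

theorem integrable_addCircle {Ω : Type*} [MeasurableSpace Ω] {P : Measure Ω} [IsFiniteMeasure P]
    {f : Ω → UnitAddCircle} (hf : AEStronglyMeasurable f P) : Integrable f P :=
  .of_bound hf (1 / 2) (ae_of_all _ fun ω => by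
    simpa using AddCircle.norm_le_half_period (1 : ℝ) one_ne_zero)

section

variable {Ω : Type*} [MeasurableSpace Ω] {P : Measure Ω}

theorem l1_norm_eq_integral (f : Ω →₁[P] UnitAddCircle) : ‖f‖ = ∫ ω, ‖f ω‖ ∂P := by
  rw [L1.norm_def, integral_norm_eq_lintegral_enorm (L1.aestronglyMeasurable_coeFn f)]

theorem l1_coeFn_nsmul (n : ℕ) (f : Ω →₁[P] UnitAddCircle) :
    ⇑(n • f) =ᵐ[P] fun ω => n • f ω := by
  induction n with
  | zero =>
    simp only [zero_nsmul]
    exact Lp.coeFn_zero _ _ _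
  | succ n ih =>
    simp only [succ_nsmul]
    filter_upwards [Lp.coeFn_add (n • f) f, ih] with ω h1 h2
    rw [h1, Pi.add_apply, h2]

theorem l1_exists_div [IsProbabilityMeasure P] {N : ℕ} (hN : 0 < N) (f : Ω →₁[P] UnitAddCircle) :
    ∃ g : Ω →₁[P] UnitAddCircle, N • g = f ∧ ‖g‖ ≤ 1 / (N : ℝ) ∧ ∀ᵐ ω ∂P, f ω = 0 → g ω = 0 := by
  obtain ⟨h, hm, hN, hn, h0⟩ := exists_measurable_div hN
  have hint : Integrable (fun ω => h (f ω)) P := integrable_addCircle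
    (hm.comp_aemeasurable (L1.aemeasurable_coeFn f)).aestronglyMeasurable
  have hc := Integrable.coeFn_toL1 hint
  refine ⟨hint.toL1 _, ?_, ?_, ?_⟩
  · refine Lp.ext ?_
    filter_upwards [hc, l1_coeFn_nsmul N (hint.toL1 _)] with ω h1 h2
    rw [h2, h1, hN]
  · rw [l1_norm_eq_integral]
    calc ∫ ω, ‖hint.toL1 _ ω‖ ∂P ≤ ∫ _, 1 / (N : ℝ) ∂P := by
          refine integral_mono_ae (L1.integrable_coeFn _).norm (integrable_const _) ?_
          filter_upwards [hc] with ω h1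
          rw [h1]
          exact hn _
      _ = 1 / (N : ℝ) := by simp
  · filter_upwards [hc] with ω h1 h2
    rw [h1, h2, h0]

/-- The integrable circle-valued functions vanishing almost everywhere off `C`. -/
def l1SupportedOn (P : Measure Ω) (C : Set Ω) : AddSubgroup (Ω →₁[P] UnitAddCircle) where
  carrier := {f | ∀ᵐ ω ∂P, ω ∉ C → f ω = 0}
  zero_mem' := by
    filter_upwards [Lp.coeFn_zero UnitAddCircle 1 P] with ω h _
    rw [h, Pi.zero_apply]
  add_mem' {f g} hf hg := by
    rw [Set.mem_ofPred_eq] at hf hg ⊢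
    filter_upwards [Lp.coeFn_add f g, hf, hg] with ω h h1 h2 hC
    rw [h, Pi.add_apply, h1 hC, h2 hC, add_zero]
  neg_mem' {f} hf := by
    rw [Set.mem_ofPred_eq] at hf ⊢
    filter_upwards [Lp.coeFn_neg f, hf] with ω h h1 hC
    rw [h, Pi.neg_apply, h1 hC, neg_zero]

theorem mem_l1SupportedOn {C : Set Ω} {f : Ω →₁[P] UnitAddCircle} :
    f ∈ l1SupportedOn P C ↔ ∀ᵐ ω ∂P, ω ∉ C → f ω = 0 := Iff.rfl

theorem norm_le_of_mem_l1SupportedOn [IsFiniteMeasure P] {C : Set Ω} (hC : MeasurableSet C)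
    {f : Ω →₁[P] UnitAddCircle} (hf : f ∈ l1SupportedOn P C) : ‖f‖ ≤ P.real C := by
  rw [l1_norm_eq_integral, ← integral_indicator_one hC]
  refine integral_mono_ae (L1.integrable_coeFn _).norm
    ((integrable_const (1 : ℝ)).indicator hC) ?_
  filter_upwards [mem_l1SupportedOn.1 hf] with ω h
  by_cases hω : ω ∈ C
  · have := AddCircle.norm_le_half_period (1 : ℝ) one_ne_zero (x := f ω)
    simp only [hω, Set.indicator_of_mem, Pi.one_apply]
    norm_num at this
    linarith
  · simp [hω, h hω]

theorem l1SupportedOn_union_le [IsFiniteMeasure P] {C D : Set Ω} (hC : MeasurableSet C)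
    {G : AddSubgroup (Ω →₁[P] UnitAddCircle)} (hCG : l1SupportedOn P C ≤ G)
    (hDG : l1SupportedOn P D ≤ G) : l1SupportedOn P (C ∪ D) ≤ G := by
  intro f hf
  have hint := (L1.integrable_coeFn f).indicator hC
  have hc := Integrable.coeFn_toL1 hint
  have h1 : hint.toL1 _ ∈ l1SupportedOn P C := by
    rw [mem_l1SupportedOn]
    filter_upwards [hc] with ω h hω
    rw [h, Set.indicator_of_notMem hω]
  have h2 : f - hint.toL1 _ ∈ l1SupportedOn P D := by
    rw [mem_l1SupportedOn] at hf ⊢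
    filter_upwards [hc, Lp.coeFn_sub f (hint.toL1 _), hf] with ω h h' h'' hω
    rw [h', Pi.sub_apply, h]
    by_cases hωC : ω ∈ C
    · rw [Set.indicator_of_mem hωC, sub_self]
    · rw [Set.indicator_of_notMem hωC, h'' (by simp [hω, hωC]), sub_zero]
  simpa using G.add_mem (hCG h1) (hDG h2)

end

theorem l1_eq_top_of_small_divisible_le {P : Measure ℝ}
    (hP : P = volume.restrict (Set.Ioc 0 1)) {ε : ℝ} (hε : 0 < ε)
    (G : AddSubgroup (ℝ →₁[P] UnitAddCircle))
    (hG : ∀ Y : AddSubgroup (ℝ →₁[P] UnitAddCircle),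
      (∀ g ∈ Y, ‖g‖ < ε) → (∀ N : ℕ, 0 < N → ∀ f ∈ Y, ∃ g ∈ Y, N • g = f) → Y ≤ G) :
    G = ⊤ := by
  have : IsProbabilityMeasure P := ⟨by simp [hP]⟩
  have hsmall : ∀ C : Set ℝ, MeasurableSet C → P.real C < ε → l1SupportedOn P C ≤ G := by
    intro C hC hCε
    refine hG _ (fun g hg => (norm_le_of_mem_l1SupportedOn hC hg).trans_lt hCε)
      fun N hN f hf => ?_
    obtain ⟨g, hgf, -, hg⟩ := l1_exists_div hN f
    refine ⟨g, ?_, hgf⟩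
    rw [mem_l1SupportedOn] at hf ⊢
    filter_upwards [hf, hg] with ω h1 h2 hω
    exact h2 (h1 hω)
  obtain ⟨n, hn⟩ := exists_nat_one_div_lt hε
  have hind : ∀ j : ℕ, l1SupportedOn P (Set.Iic ((j : ℝ) / (n + 1))) ≤ G := by
    intro j
    induction j with
    | zero =>
      refine hsmall _ measurableSet_Iic ?_
      have : Set.Iic (0 : ℝ) ∩ Set.Ioc 0 1 = ∅ := by
        ext x; simp; intro h h'; linarith
      simpa [hP, Measure.real, Measure.restrict_apply measurableSet_Iic, this] using hε
    | succ j ih =>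
      have hle : (j : ℝ) / (n + 1) ≤ ((j + 1 : ℕ) : ℝ) / (n + 1) := by
        gcongr
        simp
      rw [← Set.Iic_union_Ioc_eq_Iic hle]
      refine l1SupportedOn_union_le measurableSet_Iic ih (hsmall _ measurableSet_Ioc ?_)
      refine lt_of_le_of_lt ?_ hn
      rw [hP]
      refine (ENNReal.toReal_mono (by simp)
        (Measure.restrict_apply_le (Set.Ioc (0 : ℝ) 1) _)).trans ?_
      rw [Real.volume_Ioc, ENNReal.toReal_ofReal (by linarith)]
      push_cast
      apply le_of_eq
      ring
  subst hP
  refine top_unique fun f _ => hind (n + 1) ?_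
  rw [mem_l1SupportedOn]
  have h1 : ((n + 1 : ℕ) : ℝ) / (n + 1) = 1 := by
    push_cast
    exact div_self (by positivity)
  rw [h1]
  filter_upwards [ae_restrict_mem (measurableSet_Ioc (a := (0 : ℝ)) (b := 1))] with x hx hx'
  exact absurd hx.2 hx'

theorem exists_set_nsmul_near {g : ℕ → ℝ}
    (hg : ∀ (θ : UnitAddCircle) (k : ℤ) (M : ℕ) (ε : ℝ), 0 < ε →
      ∃ m : ℕ, M ≤ m ∧ ‖m • θ - k • θ‖ < ε ∧ g m < ε) :
    ∃ A : Set ℕ, (∀ ε : ℝ, 0 < ε → {m ∈ A | ε ≤ g m}.Finite) ∧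
      ∀ (θ : UnitAddCircle) (k : ℤ) (M : ℕ) (ε : ℝ), 0 < ε →
        ∃ m ∈ A, M ≤ m ∧ ‖m • θ - k • θ‖ < ε := by
  have hF : ∀ (s : ℕ) (k : ℤ), ∃ F : Set ℕ, F.Finite ∧
      (∀ m ∈ F, s ≤ m ∧ g m < 1 / ((s : ℝ) + 1)) ∧
      ∀ θ : UnitAddCircle, ∃ m ∈ F, ‖m • θ - k • θ‖ < 1 / ((s : ℝ) + 1) := by
    intro s k
    obtain ⟨F, hFs, hF, hFc⟩ := isCompact_univ.elim_finite_subcover_image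
      (b := {m : ℕ | s ≤ m ∧ g m < 1 / ((s : ℝ) + 1)})
      (c := fun m => {θ : UnitAddCircle | ‖m • θ - k • θ‖ < 1 / ((s : ℝ) + 1)})
      (fun m _ => isOpen_lt (by fun_prop) continuous_const)
      (fun θ _ => by
        obtain ⟨m, h1, h2, h3⟩ := hg θ k s (1 / ((s : ℝ) + 1)) (by positivity)
        exact Set.mem_biUnion (x := m) ⟨h1, h3⟩ h2)
    refine ⟨F, hF, fun m hm => hFs hm, fun θ => ?_⟩
    obtain ⟨m, hm, h⟩ := Set.mem_iUnion₂.1 (hFc (Set.mem_univ θ))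
    exact ⟨m, hm, h⟩
  choose F hFfin hFg hFθ using hF
  refine ⟨⋃ s : ℕ, ⋃ k ∈ Set.Icc (-(s : ℤ)) s, F s k, fun ε hε => ?_, fun θ k M ε hε => ?_⟩
  · obtain ⟨n, hn⟩ := exists_nat_one_div_lt hε
    refine Set.Finite.subset ((Set.finite_Iio n).biUnion fun s _ =>
      (Set.finite_Icc (-(s : ℤ)) s).biUnion fun k _ => hFfin s k) ?_
    rintro m ⟨hm, hmε⟩
    obtain ⟨s, hm⟩ := Set.mem_iUnion.1 hm
    refine Set.mem_biUnion (x := s) ?_ hm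
    obtain ⟨k, -, hm⟩ := Set.mem_iUnion₂.1 hm
    by_contra hs
    have hns : n ≤ s := not_lt.1 hs
    have : 1 / ((s : ℝ) + 1) ≤ 1 / ((n : ℝ) + 1) := by gcongr
    linarith [(hFg s k m hm).2]
  · obtain ⟨n, hn⟩ := exists_nat_one_div_lt hε
    obtain ⟨s, hs1, hs2, hs3⟩ : ∃ s : ℕ, n ≤ s ∧ M ≤ s ∧ k.natAbs ≤ s :=
      ⟨n + M + k.natAbs, by omega, by omega, by omega⟩
    obtain ⟨m, hm, hmθ⟩ := hFθ s k θ
    refine ⟨m, Set.mem_iUnion.2 ⟨s, Set.mem_biUnion (x := k) ?_ hm⟩,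
      hs2.trans (hFg s k m hm).1, hmθ.trans_le ?_⟩
    · constructor <;> omega
    · have : 1 / ((s : ℝ) + 1) ≤ 1 / ((n : ℝ) + 1) := by gcongr
      exact this.trans hn.le

theorem Ico_subset_closure_fract {A : Set ℕ} {θ : ℝ} (hθ : Irrational θ)
    (hA : ∀ (θ : UnitAddCircle) (k : ℤ) (ε : ℝ), 0 < ε → ∃ m ∈ A, ‖m • θ - k • θ‖ < ε) :
    Set.Ico (0 : ℝ) 1 ⊆ closure ((fun m : ℕ => Int.fract ((m : ℝ) * θ)) '' A) := by
  have hsub : Set.Ico (0 : ℝ) 1 ⊆ closure (Set.Ioo 0 1) := by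
    rw [closure_Ioo zero_ne_one]
    exact Set.Ico_subset_Icc_self
  refine hsub.trans (closure_minimal ?_ isClosed_closure)
  rintro y ⟨hy0, hy1⟩
  rw [Metric.mem_closure_iff]
  intro ε hε
  obtain ⟨δ, hδ, hδε, hδ0, hδ1⟩ : ∃ δ > 0, δ ≤ ε ∧ δ ≤ y ∧ δ ≤ 1 - y :=
    ⟨min ε (min y (1 - y)), by simp [hε, hy0, hy1], min_le_left _ _,
      (min_le_right _ _).trans (min_le_left _ _), (min_le_right _ _).trans (min_le_right _ _)⟩
  have hd : DenseRange (fun k : ℤ => k • (θ : UnitAddCircle)) :=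
    AddCircle.denseRange_zsmul_coe_iff.2 (by simpa using hθ)
  obtain ⟨k, hk⟩ := hd.exists_dist_lt (y : UnitAddCircle) (half_pos hδ)
  obtain ⟨m, hm, hmk⟩ := hA θ k (δ / 2) (half_pos hδ)
  refine ⟨_, ⟨m, hm, rfl⟩, ?_⟩
  have hlt : ‖(((m : ℝ) * θ - y : ℝ) : UnitAddCircle)‖ < δ := by
    have : (((m : ℝ) * θ - y : ℝ) : UnitAddCircle) =
        (m • (θ : UnitAddCircle) - k • (θ : UnitAddCircle)) - (y - k • (θ : UnitAddCircle)) := by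
      rw [sub_sub_sub_cancel_right, AddCircle.coe_sub, ← nsmul_eq_mul, AddCircle.coe_nsmul]
    rw [this]
    rw [dist_eq_norm] at hk
    exact (norm_sub_le _ _).trans_lt (by linarith)
  rw [UnitAddCircle.norm_eq, abs_lt] at hlt
  set r := round ((m : ℝ) * θ - y) with hr
  have hfr : Int.fract ((m : ℝ) * θ) = m * θ - r := by
    rw [Int.fract_eq_iff]
    exact ⟨by linarith, by linarith, r, by ring⟩
  dsimp only
  rw [hfr, Real.dist_eq, abs_lt]
  constructor <;> linarith

theorem exists_not_dvd {A : Set ℕ}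
    (hA : ∀ (θ : UnitAddCircle) (k : ℤ) (M : ℕ) (ε : ℝ), 0 < ε →
      ∃ m ∈ A, M ≤ m ∧ ‖m • θ - k • θ‖ < ε) {k : ℕ} (hk : 2 ≤ k) (M : ℕ) :
    ∃ m ∈ A, M ≤ m ∧ ¬ k ∣ m := by
  have hk0 : (k : ℝ) ≠ 0 := by positivity
  have hne : (((1 / k : ℝ) : ℝ) : UnitAddCircle) ≠ 0 := by
    rw [Ne, AddCircle.coe_eq_zero_iff]
    rintro ⟨n, hn⟩
    have h1 : ((n * k : ℤ) : ℝ) = 1 := by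
      push_cast
      rw [zsmul_eq_mul, mul_one] at hn
      rw [hn]
      field_simp
    have h2 : (n * k : ℤ) = 1 := by exact_mod_cast h1
    have h3 := Int.isUnit_iff.1 (IsUnit.of_mul_eq_one_right _ h2)
    omega
  obtain ⟨m, hm, hM, hmk⟩ := hA (((1 / k : ℝ) : ℝ) : UnitAddCircle) 1 M _ (norm_pos_iff.2 hne)
  refine ⟨m, hm, hM, ?_⟩
  rintro ⟨c, rfl⟩
  have h0 : (k * c) • (((1 / k : ℝ) : ℝ) : UnitAddCircle) = 0 := by
    rw [← AddCircle.coe_nsmul, AddCircle.coe_eq_zero_iff]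
    refine ⟨c, ?_⟩
    simp only [zsmul_eq_mul, nsmul_eq_mul]
    push_cast
    field_simp
  rw [h0, one_zsmul, zero_sub, norm_neg] at hmk
  exact lt_irrefl _ hmk

theorem real_mul_le_l1_norm {Ω : Type*} [MeasurableSpace Ω] {P : Measure Ω} [IsFiniteMeasure P]
    {B : Set Ω} (hB : MeasurableSet B) {a : ℝ} {f : Ω →₁[P] UnitAddCircle}
    (hf : ∀ᵐ ω ∂P, ω ∈ B → a ≤ ‖f ω‖) : P.real B * a ≤ ‖f‖ := by
  rw [l1_norm_eq_integral, ← smul_eq_mul, ← integral_indicator_const a hB]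
  refine integral_mono_ae ((integrable_const a).indicator hB) (L1.integrable_coeFn f).norm ?_
  filter_upwards [hf] with ω h
  by_cases hω : ω ∈ B
  · simpa [hω] using h hω
  · simp [hω]

theorem measure_preimage_singleton_eq_zero {Ω : Type*} [MeasurableSpace Ω] {P : Measure Ω}
    [IsFiniteMeasure P] {φ : Ω →₁[P] UnitAddCircle}
    (hφ : ∀ (M : ℕ) (V : Set (Ω →₁[P] UnitAddCircle)), IsOpen V → V.Nonempty →
      ∃ m, M ≤ m ∧ m • φ ∈ V)
    (hnear : ∀ (θ : UnitAddCircle) (ε : ℝ), 0 < ε →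
      ∃ m : ℕ, ‖m • θ - θ‖ < ε ∧ ‖m • φ‖ < ε) (x : UnitAddCircle) :
    P (φ ⁻¹' {x}) = 0 := by
  by_contra hne
  have hB : MeasurableSet (φ ⁻¹' {x}) := L1.measurable_coeFn φ (measurableSet_singleton x)
  have hp : 0 < P.real (φ ⁻¹' {x}) := ENNReal.toReal_pos hne (measure_ne_top _ _)
  set p := P.real (φ ⁻¹' {x})
  by_cases hx : x = 0
  · subst hx
    have hc : Integrable (fun _ : Ω => ((1 / 2 : ℝ) : UnitAddCircle)) P := integrable_const _
    obtain ⟨m, -, hm⟩ := hφ 0 (Metric.ball (hc.toL1 _) (p * (1 / 2))) Metric.isOpen_ball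
      (Metric.nonempty_ball.2 (by positivity))
    rw [Metric.mem_ball, dist_eq_norm] at hm
    refine hm.not_ge (real_mul_le_l1_norm hB ?_)
    filter_upwards [Lp.coeFn_sub (m • φ) (hc.toL1 _), l1_coeFn_nsmul m φ, hc.coeFn_toL1]
      with ω h1 h2 h3 hω
    rw [Set.mem_preimage, Set.mem_singleton_iff] at hω
    rw [h1, Pi.sub_apply, h2, h3, hω, smul_zero, zero_sub, norm_neg,
      AddCircle.norm_coe_eq_abs_iff (1 : ℝ) one_ne_zero |>.2 (by norm_num [abs_of_pos])]
    exact le_abs_self _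
  · have hx' : 0 < ‖x‖ := norm_pos_iff.2 hx
    obtain ⟨m, hmx, hmφ⟩ := hnear x (min (‖x‖ / 2) (p * (‖x‖ / 2))) (by positivity)
    refine (hmφ.trans_le (min_le_right _ _)).not_ge (real_mul_le_l1_norm hB ?_)
    filter_upwards [l1_coeFn_nsmul m φ] with ω h hω
    rw [Set.mem_preimage, Set.mem_singleton_iff] at hω
    rw [h, hω]
    have h1 := hmx.trans_le (min_le_left _ _)
    have h2 := norm_sub_norm_le x (m • x)
    rw [norm_sub_rev] at h2
    linarith

theorem exists_continuous_measure_nsmul_near :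
    ∃ μ : Measure UnitAddCircle, IsProbabilityMeasure μ ∧ (∀ x, μ {x} = 0) ∧
      ∀ (θ : UnitAddCircle) (k : ℤ) (M : ℕ) (ε : ℝ), 0 < ε →
        ∃ m : ℕ, M ≤ m ∧ ‖m • θ - k • θ‖ < ε ∧ ∫ t, ‖m • t‖ ∂μ < ε := by
  obtain ⟨P, hP⟩ : ∃ P : Measure ℝ, P = volume.restrict (Set.Ioc 0 1) := ⟨_, rfl⟩
  have : IsProbabilityMeasure P := ⟨by simp [hP]⟩
  have : Fact ((1 : ENNReal) ≠ ⊤) := ⟨ENNReal.one_ne_top⟩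
  obtain ⟨φ, hφ⟩ := exists_nsmul_dense (X := ℝ →₁[P] UnitAddCircle) fun N hN f => by
    obtain ⟨g, h1, h2, -⟩ := l1_exists_div hN f
    exact ⟨g, h1, h2⟩
  have hnear := fun θ k M ε hε => exists_nsmul_near hφ
    (fun ε hε G hG => l1_eq_top_of_small_divisible_le hP hε G hG) θ k M (ε := ε) hε
  have hm : Measurable φ := L1.measurable_coeFn φ
  refine ⟨P.map φ, Measure.isProbabilityMeasure_map hm.aemeasurable, fun x => ?_,
    fun θ k M ε hε => ?_⟩
  · rw [Measure.map_apply hm (measurableSet_singleton x)]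
    refine measure_preimage_singleton_eq_zero hφ (fun θ ε hε => ?_) x
    obtain ⟨m, -, h1, h2⟩ := hnear θ 1 0 ε hε
    exact ⟨m, by simpa using h1, h2⟩
  · obtain ⟨m, h1, h2, h3⟩ := hnear θ k M ε hε
    refine ⟨m, h1, h2, ?_⟩
    rw [integral_map hm.aemeasurable (by fun_prop)]
    rw [l1_norm_eq_integral] at h3
    refine (le_of_eq ?_).trans_lt h3
    refine integral_congr_ae ?_
    filter_upwards [l1_coeFn_nsmul m φ] with ω h
    rw [h]

/-- There exist a strictly increasing sequence of natural numbers `(m_n)` and an atomless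
Borel probability measure `μ` on the circle `ℝ/ℤ` such that: (1) for every irrational `θ`
the sequence of fractional parts `(m_n θ [1])` is dense in `[0,1)`; (2) for every `k ≥ 2`
the set `{n : k ∤ m_n}` is infinite; (3) `∫ ‖m_n θ‖ dμ(θ) → 0`. -/
theorem stmt0 :
    ∃ m : ℕ → ℕ, StrictMono m ∧
      (∀ θ : ℝ, Irrational θ →
        Set.Ico (0:ℝ) 1 ⊆ closure (Set.range fun n : ℕ => Int.fract ((m n : ℝ) * θ))) ∧
      (∀ k : ℕ, 2 ≤ k → {n : ℕ | ¬ (k ∣ m n)}.Infinite) ∧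
      ∃ μ : Measure UnitAddCircle, IsProbabilityMeasure μ ∧
        (∀ x : UnitAddCircle, μ {x} = 0) ∧
        Tendsto (fun n : ℕ => ∫ θ : UnitAddCircle, ‖(m n) • θ‖ ∂μ) atTop (nhds 0) := by
  obtain ⟨μ, hμ, hμ0, hnear⟩ := exists_continuous_measure_nsmul_near
  obtain ⟨A, hAfin, hA⟩ := exists_set_nsmul_near (g := fun m => ∫ t, ‖m • t‖ ∂μ) hnear
  have hAinf : A.Infinite := Set.infinite_of_forall_exists_gt fun M => by
    obtain ⟨m, hm, hM, -⟩ := hA 0 0 (M + 1) 1 one_pos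
    exact ⟨m, hm, hM⟩
  have hmono : StrictMono (Nat.nth (· ∈ A)) := Nat.nth_strictMono hAinf
  have hrange : Set.range (Nat.nth (· ∈ A)) = A := Nat.range_nth_of_infinite hAinf
  refine ⟨Nat.nth (· ∈ A), hmono, fun θ hθ => ?_, fun k hk => ?_, μ, hμ, hμ0, ?_⟩
  · refine (Ico_subset_closure_fract (A := A) hθ fun θ k ε hε => ?_).trans_eq ?_
    · obtain ⟨m, hm, -, h⟩ := hA θ k 0 ε hε
      exact ⟨m, hm, h⟩
    · conv_lhs => rw [← hrange, ← Set.range_comp]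
      rfl
  · refine Set.infinite_of_forall_exists_gt fun N => ?_
    obtain ⟨m, hm, hM, hkm⟩ := exists_not_dvd hA hk (Nat.nth (· ∈ A) N + 1)
    obtain ⟨n, rfl⟩ := hrange.symm ▸ hm
    exact ⟨n, hkm, hmono.lt_iff_lt.1 hM⟩
  · rw [Metric.tendsto_nhds]
    intro ε hε
    rw [← Nat.cofinite_eq_atTop, eventually_cofinite]
    refine ((hAfin ε hε).preimage (f := Nat.nth (· ∈ A)) hmono.injective.injOn).subset ?_
    intro n hn
    rw [Set.mem_ofPred_eq, Real.dist_0_eq_abs, abs_of_nonneg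
      (integral_nonneg fun _ => norm_nonneg _), not_lt] at hn
    exact ⟨Nat.nth_mem_of_infinite hAinf n, hn⟩
end

section
/- Let (α_i)_{i≥1} be real numbers such that the family {1, α_1, α_2, ...} is linearly independent over ℚ. Then there exists a strictly increasing sequence of natural numbers (m_n)_{n≥1} such that: (1) for every irrational real number θ, the sequence of fractional parts (m_n θ [1])_{n≥1} is dense in [0,1); (2) for every ε > 0 and every k ∈ ℕ there exists N_0 ∈ ℕ such that for every n ≥ N_0, the inequality ‖m_n α_i‖ < ε holds for at least k − 1 of the indices i ∈ {1, ..., k}; and (3) for every natural number k ≥ 2, the set {n ∈ ℕ : k does not divide m_n} is infinite. -/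
open Filter

theorem distToInt_eq_norm (x : ℝ) : distToInt x = ‖(x : UnitAddCircle)‖ :=
  UnitAddCircle.norm_eq.symm

theorem continuous_distToInt : Continuous distToInt := by
  rw [show distToInt = fun x : ℝ => ‖(x : UnitAddCircle)‖ from funext distToInt_eq_norm]
  exact continuous_norm.comp (AddCircle.continuous_mk' 1)

theorem distToInt_le (x : ℝ) (z : ℤ) : distToInt x ≤ |x - z| := round_le x z

section Torus

open UnitAddTorus MeasureTheory

variable {d : Type*} [Fintype d]

theorem mFourier_apply_add (n : d → ℤ) (x y : UnitAddTorus d) :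
    mFourier n (x + y) = mFourier n x * mFourier n y := by
  simp [mFourier, fourier_apply, smul_add, AddCircle.toCircle_add, Finset.prod_mul_distrib]

theorem mFourier_apply_nsmul (n : d → ℤ) (x : UnitAddTorus d) (m : ℕ) :
    mFourier n (m • x) = mFourier n x ^ m := by
  induction m with
  | zero => simp [mFourier]
  | succ k ih => rw [succ_nsmul, mFourier_apply_add, ih, pow_succ]

theorem mFourier_apply_eq_one_iff (n : d → ℤ) (x : UnitAddTorus d) :
    mFourier n x = 1 ↔ ∑ i, n i • x i = 0 := by
  have h : mFourier n x = ((∑ i, n i • x i : UnitAddCircle).toCircle : ℂ) := by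
    have key : ∀ s : Finset d, ((∑ i ∈ s, n i • x i : UnitAddCircle).toCircle : ℂ) =
        ∏ i ∈ s, ((n i • x i : UnitAddCircle).toCircle : ℂ) := by
      classical
      intro s
      induction s using Finset.induction_on with
      | empty => simp
      | insert a s ha ih =>
        rw [Finset.sum_insert ha, Finset.prod_insert ha, AddCircle.toCircle_add,
          Circle.coe_mul, ih]
    rw [key]
    simp [mFourier, fourier_apply]
  rw [h, Circle.coe_eq_one, ← AddCircle.toCircle_zero (T := 1)]
  exact (AddCircle.injective_toCircle one_ne_zero).eq_iff

/-- If no nontrivial character of the torus is trivial at `b`, then averages of trigonometric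
polynomials along the multiples of `b` converge to the integral. -/
theorem tendsto_average_of_mem_span_mFourier (μ : Measure (UnitAddTorus d))
    [IsProbabilityMeasure μ] [μ.IsAddLeftInvariant] (b : UnitAddTorus d)
    (hb : ∀ n : d → ℤ, mFourier n b = 1 → n = 0) {p : C(UnitAddTorus d, ℂ)}
    (hp : p ∈ Submodule.span ℂ (Set.range (mFourier (d := d)))) :
    Tendsto (fun N : ℕ => (N : ℂ)⁻¹ * ∑ m ∈ Finset.range N, p (m • b)) atTop
      (nhds (∫ x, p x ∂μ)) := by
  induction hp using Submodule.span_induction with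
  | zero => simp
  | add f g _ _ hf hg =>
    have hint : ∀ h : C(UnitAddTorus d, ℂ), Integrable h μ := fun h =>
      h.continuous.integrable_of_hasCompactSupport (HasCompactSupport.of_compactSpace _)
    simp only [ContinuousMap.add_apply, Finset.sum_add_distrib, mul_add]
    rw [integral_add (hint f) (hint g)]
    exact hf.add hg
  | smul a f _ hf =>
    simp only [ContinuousMap.smul_apply, smul_eq_mul, ← Finset.mul_sum, integral_const_mul]
    exact (hf.const_mul a).congr fun N => by ring
  | mem f hf =>
    obtain ⟨n, rfl⟩ := hf
    by_cases hn : n = 0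
    · subst hn
      refine tendsto_const_nhds.congr' ?_
      filter_upwards [eventually_gt_atTop 0] with N hN
      have : (N : ℂ) ≠ 0 := by exact_mod_cast hN.ne'
      simp [mFourier_zero, this]
    · have hw : mFourier n b ≠ 1 := fun h => hn (hb n h)
      have hzero : ∫ x, mFourier n x ∂μ = 0 := by
        have h := integral_add_left_eq_self (μ := μ) (fun x => mFourier n x) b
        simp only [mFourier_apply_add, integral_const_mul] at h
        have h' : (mFourier n b - 1) * ∫ x, mFourier n x ∂μ = 0 := by linear_combination h
        exact (mul_eq_zero.mp h').resolve_left (sub_ne_zero.mpr hw)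
      rw [hzero]
      simp only [mFourier_apply_nsmul, geom_sum_eq hw]
      have hnorm : ‖mFourier n b‖ ≤ 1 :=
        ((mFourier n).norm_coe_le_norm b).trans_eq mFourier_norm
      refine squeeze_zero_norm (a := fun N : ℕ => (N : ℝ)⁻¹ * (2 / ‖mFourier n b - 1‖))
        (fun N => ?_) ?_
      · rw [norm_mul, norm_inv, Complex.norm_natCast, norm_div]
        gcongr
        calc ‖mFourier n b ^ N - 1‖ ≤ ‖mFourier n b ^ N‖ + ‖(1 : ℂ)‖ := norm_sub_le _ _
          _ ≤ 1 + 1 := by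
            gcongr
            · rw [norm_pow]; exact pow_le_one₀ (norm_nonneg _) hnorm
            · simp
          _ = 2 := by norm_num
      · simpa using (tendsto_inv_atTop_nhds_zero_nat (𝕜 := ℝ)).mul_const
          (2 / ‖mFourier n b - 1‖)

/-- If no nontrivial character of the torus is trivial at `b`, then the multiples of `b` are
dense. -/
theorem exists_dist_nsmul_lt (b : UnitAddTorus d)
    (hb : ∀ n : d → ℤ, mFourier n b = 1 → n = 0) (c : UnitAddTorus d) {ε : ℝ} (hε : 0 < ε) :
    ∃ m : ℕ, dist (m • b) c < ε := by
  by_contra! hfar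
  let μ : Measure (UnitAddTorus d) := Measure.addHaarMeasure ⊤
  have : IsProbabilityMeasure μ := ⟨Measure.addHaarMeasure_self⟩
  let g : C(UnitAddTorus d, ℝ) := ⟨fun x => max 0 (ε - dist x c), by fun_prop⟩
  let f : C(UnitAddTorus d, ℂ) := ⟨fun x => (g x : ℂ), by fun_prop⟩
  have hpos : 0 < ∫ x, g x ∂μ :=
    g.continuous.integral_pos_of_hasCompactSupport_nonneg_nonzero
      (HasCompactSupport.of_compactSpace _) (fun x => le_max_left _ _)
      (x := c) (by simp [g, hε.ne', hε.le])
  have hf : ∫ x, f x ∂μ = ((∫ x, g x ∂μ : ℝ) : ℂ) := integral_ofReal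
  have hf0 : ∀ m : ℕ, f (m • b) = 0 := fun m => by simp [f, g, hfar m]
  have hmem : f ∈ (Submodule.span ℂ (Set.range (mFourier (d := d)))).topologicalClosure := by
    rw [span_mFourier_closure_eq_top]; trivial
  obtain ⟨p, hp, hfp⟩ := Metric.mem_closure_iff.mp hmem ((∫ x, g x ∂μ) / 2) (half_pos hpos)
  have hlt : ∀ x, ‖p x - f x‖ ≤ dist f p := fun x => by
    rw [← dist_eq_norm, dist_comm]
    exact ContinuousMap.dist_apply_le_dist x
  have hlim := tendsto_average_of_mem_span_mFourier μ b hb hp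
  have hp_le : ‖∫ x, p x ∂μ‖ ≤ dist f p := by
    refine le_of_tendsto hlim.norm (Eventually.of_forall fun N => ?_)
    rw [norm_mul, norm_inv, Complex.norm_natCast]
    have hsum : ‖∑ m ∈ Finset.range N, p (m • b)‖ ≤ N * dist f p := by
      have h := norm_sum_le_of_le (Finset.range N) (f := fun m => p (m • b))
        (n := fun _ => dist f p) fun m _ => by simpa [hf0 m] using hlt (m • b)
      simpa using h
    rcases N.eq_zero_or_pos with rfl | hN
    · simp
    · rwa [inv_mul_le_iff₀ (by exact_mod_cast hN)]
  have hint : ∀ h : C(UnitAddTorus d, ℂ), Integrable h μ := fun h =>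
    h.continuous.integrable_of_hasCompactSupport (HasCompactSupport.of_compactSpace _)
  have hdiff : ‖∫ x, p x ∂μ - ∫ x, f x ∂μ‖ ≤ dist f p := by
    rw [← integral_sub (hint p) (hint f)]
    refine (norm_integral_le_of_norm_le_const (Eventually.of_forall hlt)).trans_eq ?_
    simp
  have hfinal : ‖∫ x, f x ∂μ‖ ≤ 2 * dist f p := by
    have := norm_sub_le (∫ x, p x ∂μ) (∫ x, p x ∂μ - ∫ x, f x ∂μ)
    rw [sub_sub_cancel] at this
    linarith
  rw [hf, Complex.norm_real, Real.norm_of_nonneg hpos.le] at hfinal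
  linarith

end Torus

/-- The reals `β i` are linearly independent over `ℚ` modulo `ℚ`, stated with integer
coefficients. -/
def RationallyIndependent {d : Type*} [Fintype d] (β : d → ℝ) : Prop :=
  ∀ (n : d → ℤ) (z : ℤ), ∑ i, n i * β i = z → n = 0

/-- Kronecker's theorem on simultaneous inhomogeneous approximation. -/
theorem RationallyIndependent.exists_distToInt_lt {d : Type*} [Fintype d] {β : d → ℝ}
    (hβ : RationallyIndependent β) (c : d → ℝ) {ε : ℝ} (hε : 0 < ε) :
    ∃ m : ℕ, ∀ i, distToInt (m * β i - c i) < ε := by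
  obtain ⟨m, hm⟩ := exists_dist_nsmul_lt (fun i => (β i : UnitAddCircle))
    (fun n hn => by
      rw [mFourier_apply_eq_one_iff] at hn
      have h : ((∑ i, n i * β i : ℝ) : UnitAddCircle) = 0 := by
        rw [← hn, ← QuotientAddGroup.mk'_apply, map_sum]
        refine Finset.sum_congr rfl fun i _ => ?_
        rw [← zsmul_eq_mul, map_zsmul, QuotientAddGroup.mk'_apply]
      obtain ⟨z, hz⟩ := (AddCircle.coe_eq_zero_iff 1).mp h
      exact hβ n z (by simpa using hz.symm))
    (fun i => (c i : UnitAddCircle)) hε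
  refine ⟨m, fun i => ?_⟩
  rw [distToInt_eq_norm]
  have h := (dist_pi_lt_iff hε).mp hm i
  rw [dist_eq_norm] at h
  simpa [← nsmul_eq_mul] using h

theorem RationallyIndependent.exists_progression {d : Type*} [Fintype d] {β : d → ℝ}
    (hβ : RationallyIndependent β) {q : ℕ} (hq : q ≠ 0) (r : ℕ) {ε : ℝ} (hε : 0 < ε) :
    ∃ t : ℕ, ∀ i, distToInt ((r + q * t : ℕ) * β i) < ε := by
  have hq' : RationallyIndependent fun i => q * β i := fun n z h => by
    have := hβ (fun i => n i * q) z (by rw [← h]; push_cast; simp only [mul_assoc])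
    funext i
    simpa [hq] using congrFun this i
  obtain ⟨t, ht⟩ := hq'.exists_distToInt_lt (fun i => -(r * β i)) hε
  refine ⟨t, fun i => ?_⟩
  convert ht i using 2
  push_cast
  ring

/-- All the numbers `m * α i` with `i ≤ K`, with at most one exception, are within `1 / (K + 1)`
of an integer. -/
def AlmostReturns (α : ℕ → ℝ) (K m : ℕ) : Prop :=
  ∃ j, ∀ i ≤ K, i ≠ j → distToInt (m * α i) < 1 / ((K : ℝ) + 1)

theorem rationallyIndependent_of_linearIndependent {α : ℕ → ℝ}
    (hα : LinearIndependent ℚ (fun o : Option ℕ => o.elim (1 : ℝ) α)) (K : ℕ) :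
    RationallyIndependent fun i : Fin K => α i := by
  intro n z h
  have hinj : Function.Injective (Option.map (Fin.val : Fin K → ℕ)) :=
    Option.map_injective Fin.val_injective
  have hli := Fintype.linearIndependent_iff.mp (hα.comp _ hinj)
    (fun o => o.elim (-z : ℚ) fun i => (n i : ℚ)) (by
      simp [Fintype.sum_option, Rat.smul_def, h])
  funext i
  simpa using hli (some i)

/-- A coordinate of a rationally independent family can be exchanged for any given irrational
number. -/
theorem RationallyIndependent.exists_update {d : Type*} [Fintype d] [DecidableEq d] [Nonempty d]
    {β : d → ℝ} (hβ : RationallyIndependent β) {θ : ℝ} (hθ : Irrational θ) :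
    ∃ j, RationallyIndependent (Function.update β j θ) := by
  have hsum : ∀ (n : d → ℤ) (j : d), ∑ i, n i * Function.update β j θ i =
      n j * θ + ∑ i, (Function.update n j 0 i : ℤ) * β i := by
    intro n j
    rw [← Finset.add_sum_erase _ _ (Finset.mem_univ j),
      ← Finset.add_sum_erase _ (fun i => (Function.update n j 0 i : ℝ) * β i) (Finset.mem_univ j)]
    simp only [Function.update_self, Int.cast_zero, zero_mul, zero_add]
    congr 1
    refine Finset.sum_congr rfl fun i hi => ?_
    rw [Function.update_of_ne (Finset.ne_of_mem_erase hi),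
      Function.update_of_ne (Finset.ne_of_mem_erase hi)]
  have hrest : ∀ (n : d → ℤ) (j : d), n j = 0 → Function.update n j 0 = 0 → n = 0 := by
    intro n j hj hn
    rwa [← hj, Function.update_eq_self] at hn
  by_cases hdep : ∃ (b : ℤ) (a : d → ℤ) (z : ℤ), b ≠ 0 ∧ b * θ = ∑ i, a i * β i + z
  · obtain ⟨b, a, z, hb, hrel⟩ := hdep
    obtain ⟨j, hj⟩ : ∃ j, a j ≠ 0 := by
      by_contra! ha
      refine (hθ.intCast_mul hb).ne_int z ?_
      simpa [ha] using hrel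
    refine ⟨j, fun n w h => ?_⟩
    rw [hsum] at h
    have hcomb := hβ (fun i => n j * a i + b * Function.update n j 0 i) (b * w - n j * z) (by
      push_cast
      simp only [add_mul, mul_assoc, Finset.sum_add_distrib, ← Finset.mul_sum]
      linear_combination b * h - n j * hrel)
    have hnj : n j = 0 := by simpa [hj] using congrFun hcomb j
    refine hrest n j hnj (funext fun i => ?_)
    simpa [hnj, hb] using congrFun hcomb i
  · push Not at hdep
    obtain ⟨j⟩ := ‹Nonempty d›
    refine ⟨j, fun n w h => ?_⟩
    rw [hsum] at h
    have hnj : n j = 0 := by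
      by_contra hnj
      refine hdep (n j) (-Function.update n j 0) w hnj ?_
      simp only [Pi.neg_apply, Int.cast_neg, neg_mul, Finset.sum_neg_distrib]
      linear_combination h
    refine hrest n j hnj (hβ _ w ?_)
    simpa [hnj] using h

/-- A fraction in lowest terms whose denominator exceeds `N` has multiples `1 / N`-close to any
real number modulo one, the multiplier depending only on its class modulo the denominator. -/
theorem exists_residue_distToInt_lt (θ : ℚ) {N : ℕ} (hN : 0 < N) (hden : N < θ.den) (c : ℝ) :
    ∃ r : ℕ, ∀ t : ℕ, distToInt ((r + θ.den * t : ℕ) * (θ : ℝ) - c) < 1 / (N : ℝ) := by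
  have hq : (0 : ℝ) < θ.den := by exact_mod_cast θ.pos
  have hqz : (θ.den : ℤ) ≠ 0 := by exact_mod_cast θ.den_nz
  set s := round (c * θ.den) with hs
  have hbez := Int.gcd_eq_gcd_ab θ.num θ.den
  rw [show Int.gcd θ.num θ.den = 1 by simpa [Int.gcd] using θ.reduced] at hbez
  set a := Int.gcdA θ.num θ.den
  set b := Int.gcdB θ.num θ.den
  have hr : ((((s * a) % θ.den).toNat : ℕ) : ℤ) = (s * a) % θ.den :=
    Int.toNat_of_nonneg (Int.emod_nonneg _ hqz)
  have hdiv := Int.mul_ediv_add_emod (s * a) θ.den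
  refine ⟨((s * a) % θ.den).toNat, fun t => ?_⟩
  rw [← hr] at hdiv
  set r := ((s * a) % θ.den).toNat
  set e := (s * a) / (θ.den : ℤ)
  have hθ : (θ : ℝ) * θ.den = θ.num := by exact_mod_cast Rat.mul_den_eq_num θ
  have hbezR : (1 : ℝ) = θ.num * a + θ.den * b := by exact_mod_cast hbez
  have hdivR : (θ.den : ℝ) * e + r = s * a := by exact_mod_cast hdiv
  refine (distToInt_le _ (t * θ.num - s * b - e * θ.num)).trans_lt ?_
  have hval : ((r + θ.den * t : ℕ) * (θ : ℝ) - c - ((t * θ.num - s * b - e * θ.num : ℤ) : ℝ)) =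
      (s - c * θ.den) / θ.den := by
    rw [eq_div_iff hq.ne']
    push_cast
    linear_combination (r + θ.den * t) * hθ + θ.num * hdivR - s * hbezR
  rw [hval, abs_div, abs_of_pos hq, abs_sub_comm, div_lt_div_iff₀ hq (by exact_mod_cast hN), one_mul]
  have hround := abs_sub_round (c * θ.den)
  have hNq : (N : ℝ) < θ.den := by exact_mod_cast hden
  have hN' : (0 : ℝ) < N := by exact_mod_cast hN
  rw [← hs] at hround
  nlinarith

theorem exists_almostReturns_distToInt_lt {α : ℕ → ℝ}
    (hα : LinearIndependent ℚ (fun o : Option ℕ => o.elim (1 : ℝ) α)) (K : ℕ) {N : ℕ}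
    (hN : 0 < N) {θ : ℝ} (hθ : ∀ q : ℕ, 0 < q → q ≤ N → distToInt (q * θ) ≠ 0) (c : ℝ) :
    ∃ m, AlmostReturns α K m ∧ distToInt (m * θ - c) < 1 / (N : ℝ) := by
  have hβ := rationallyIndependent_of_linearIndependent hα (K + 1)
  have hK : (0 : ℝ) < 1 / ((K : ℝ) + 1) := by positivity
  have hN' : (0 : ℝ) < 1 / (N : ℝ) := by positivity
  by_cases hirr : Irrational θ
  · obtain ⟨j, hj⟩ := hβ.exists_update hirr
    obtain ⟨m, hm⟩ := hj.exists_distToInt_lt (Pi.single j c) (lt_min hK hN')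
    refine ⟨m, ⟨j, fun i hi hij => ?_⟩, ?_⟩
    · have hne : (⟨i, Nat.lt_succ_of_le hi⟩ : Fin (K + 1)) ≠ j := fun h => hij (by simp [← h])
      have h := hm ⟨i, Nat.lt_succ_of_le hi⟩
      rw [Function.update_of_ne hne, Pi.single_eq_of_ne hne, sub_zero] at h
      exact h.trans_le (min_le_left _ _)
    · have h := hm j
      rw [Function.update_self, Pi.single_eq_same] at h
      exact h.trans_le (min_le_right _ _)
  · obtain ⟨θ, rfl⟩ : ∃ x : ℚ, (x : ℝ) = θ := by simpa [Irrational] using hirr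
    have hden : N < θ.den := by
      by_contra! hle
      refine hθ θ.den θ.pos hle ?_
      have hnum : (θ.den : ℝ) * (θ : ℝ) = (θ.num : ℤ) := by exact_mod_cast Rat.den_mul_eq_num θ
      simp [distToInt, hnum]
    obtain ⟨r, hr⟩ := exists_residue_distToInt_lt θ hN hden c
    obtain ⟨t, ht⟩ := hβ.exists_progression θ.den_nz r hK
    exact ⟨_, ⟨K + 1, fun i hi _ => ht ⟨i, Nat.lt_succ_of_le hi⟩⟩, hr t⟩

/-- A finite set of `AlmostReturns` whose multiples of `θ` are `1 / N`-dense modulo one, uniformly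
over the bounded `θ` staying away from the fractions of denominator at most `N`. -/
theorem exists_finset_uniform {α : ℕ → ℝ}
    (hα : LinearIndependent ℚ (fun o : Option ℕ => o.elim (1 : ℝ) α)) (K N : ℕ) :
    ∃ F : Finset ℕ, (∀ m ∈ F, AlmostReturns α K m) ∧ ∀ θ c : ℝ, 0 < N → |θ| ≤ K →
      c ∈ Set.Icc (0 : ℝ) 1 →
      (∀ q : ℕ, 0 < q → q ≤ N → 1 / ((K : ℝ) + 1) ≤ distToInt (q * θ)) →
      ∃ m ∈ F, distToInt (m * θ - c) < 1 / (N : ℝ) := by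
  classical
  rcases N.eq_zero_or_pos with rfl | hN
  · exact ⟨∅, by simp, by simp⟩
  let C : Set (ℝ × ℝ) := (Set.Icc (-K : ℝ) K ×ˢ Set.Icc (0 : ℝ) 1) ∩
    {x | ∀ q : ℕ, 0 < q → q ≤ N → 1 / ((K : ℝ) + 1) ≤ distToInt (q * x.1)}
  have hC : IsCompact C := by
    refine (isCompact_Icc.prod isCompact_Icc).inter_right ?_
    simp only [Set.ofPred_forall]
    refine isClosed_iInter fun q => isClosed_iInter fun _ => isClosed_iInter fun _ => ?_
    exact isClosed_le continuous_const
      (continuous_distToInt.comp (continuous_const.mul continuous_fst))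
  obtain ⟨F, hF⟩ := hC.elim_finite_subcover
    (fun m : {m // AlmostReturns α K m} =>
      {x : ℝ × ℝ | distToInt (m.1 * x.1 - x.2) < 1 / (N : ℝ)})
    (fun m => isOpen_lt (continuous_distToInt.comp (by fun_prop)) continuous_const)
    (fun x hx => by
      obtain ⟨m, hm, hlt⟩ := exists_almostReturns_distToInt_lt hα K hN (θ := x.1)
        (fun q hq hqN => ((by positivity : (0 : ℝ) < 1 / ((K : ℝ) + 1)).trans_le
          (hx.2 q hq hqN)).ne') x.2
      exact Set.mem_iUnion.mpr ⟨⟨m, hm⟩, hlt⟩)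
  refine ⟨F.image Subtype.val, ?_, fun θ c _ hθ hc hq => ?_⟩
  · rintro m hm
    obtain ⟨m, -, rfl⟩ := Finset.mem_image.mp hm
    exact m.2
  · have hmem : (θ, c) ∈ C := ⟨⟨abs_le.mp hθ, hc⟩, hq⟩
    obtain ⟨m, hm, hlt⟩ := Set.mem_iUnion₂.mp (hF hmem)
    exact ⟨m, Finset.mem_image_of_mem _ hm, hlt⟩

theorem exists_block {α : ℕ → ℝ}
    (hα : LinearIndependent ℚ (fun o : Option ℕ => o.elim (1 : ℝ) α)) (K : ℕ) :
    ∃ F : Finset ℕ, (∀ m ∈ F, AlmostReturns α K m) ∧ (∃ m ∈ F, K ≤ m ∧ m ≡ 1 [MOD K]) ∧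
      ∀ (N : ℕ) (θ c : ℝ), 0 < N → N ≤ K → |θ| ≤ K → c ∈ Set.Icc (0 : ℝ) 1 →
      (∀ q : ℕ, 0 < q → q ≤ N → 1 / ((K : ℝ) + 1) ≤ distToInt (q * θ)) →
      ∃ m ∈ F, distToInt (m * θ - c) < 1 / (N : ℝ) := by
  classical
  choose F hF hcover using exists_finset_uniform hα K
  obtain ⟨x, hx, hKx, hmod⟩ : ∃ x, AlmostReturns α K x ∧ K ≤ x ∧ x ≡ 1 [MOD K] := by
    rcases K.eq_zero_or_pos with rfl | hK
    · refine ⟨1, ⟨0, fun i hi h => absurd (Nat.le_zero.mp hi) h⟩, Nat.zero_le _, rfl⟩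
    · obtain ⟨t, ht⟩ := (rationallyIndependent_of_linearIndependent hα (K + 1)).exists_progression
        hK.ne' (1 + K) (ε := 1 / ((K : ℝ) + 1)) (by positivity)
      refine ⟨1 + K + K * t, ⟨K + 1, fun i hi _ => ht ⟨i, Nat.lt_succ_of_le hi⟩⟩, by lia, ?_⟩
      simp [Nat.ModEq]
  refine ⟨insert x ((Finset.range (K + 1)).biUnion F), fun m hm => ?_,
    ⟨x, Finset.mem_insert_self _ _, hKx, hmod⟩, fun N θ c hN hNK hθ hc hq => ?_⟩
  · rcases Finset.mem_insert.mp hm with rfl | hm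
    · exact hx
    · obtain ⟨N, -, hm⟩ := Finset.mem_biUnion.mp hm
      exact hF N m hm
  · obtain ⟨m, hm, hlt⟩ := hcover N θ c hN hθ hc hq
    exact ⟨m, Finset.mem_insert_of_mem
      (Finset.mem_biUnion.mpr ⟨N, Finset.mem_range.mpr (by lia), hm⟩), hlt⟩

theorem Irrational.distToInt_pos {x : ℝ} (hx : Irrational x) : 0 < distToInt x :=
  abs_pos.mpr (sub_ne_zero.mpr (hx.ne_int _))

theorem abs_fract_sub_lt {x c δ : ℝ} (h : distToInt (x - c) < δ) (hδ : δ ≤ c)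
    (hδ' : δ ≤ 1 - c) : |Int.fract x - c| < δ := by
  have h' := abs_lt.mp h
  have hfloor : ⌊x⌋ = round (x - c) :=
    Int.floor_eq_iff.mpr ⟨by linarith [h'.1], by linarith [h'.2]⟩
  rw [Int.fract, hfloor, sub_right_comm]
  exact h

/-- A sequence running through a union of blocks covering every `θ` at all large scales has
dense fractional parts. -/
theorem Ico_subset_closure_range_fract {m : ℕ → ℕ} {F : ℕ → Finset ℕ} {θ : ℝ}
    (hθ : Irrational θ) (hm : ∀ K, ∀ x ∈ F K, x ∈ Set.range m)
    (hF : ∀ K N : ℕ, ∀ c : ℝ, 0 < N → N ≤ K → |θ| ≤ K → c ∈ Set.Icc (0 : ℝ) 1 →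
      (∀ q : ℕ, 0 < q → q ≤ N → 1 / ((K : ℝ) + 1) ≤ distToInt (q * θ)) →
      ∃ x ∈ F K, distToInt (x * θ - c) < 1 / (N : ℝ)) :
    Set.Ico (0 : ℝ) 1 ⊆ closure (Set.range fun n : ℕ => Int.fract ((m n : ℝ) * θ)) := by
  have hIoo : Set.Ioo (0 : ℝ) 1 ⊆ closure (Set.range fun n : ℕ => Int.fract ((m n : ℝ) * θ)) := by
    intro c hc
    refine Metric.mem_closure_iff.mpr fun ε hε => ?_
    obtain ⟨N, hN⟩ := exists_nat_one_div_lt (lt_min hε (lt_min hc.1 (sub_pos.mpr hc.2)))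
    obtain ⟨hNε, hNc, hNc'⟩ := lt_min_iff.mp hN |>.imp_right lt_min_iff.mp
    have hsep : ∀ᶠ K : ℕ in atTop, ∀ q ∈ Finset.Icc 1 (N + 1),
        1 / ((K : ℝ) + 1) ≤ distToInt (q * θ) := by
      refine (Finset.eventually_all _).mpr fun q hq => ?_
      have hpos := (hθ.natCast_mul (m := q) (by have := Finset.mem_Icc.mp hq; lia)).distToInt_pos
      exact (tendsto_one_div_add_atTop_nhds_zero_nat.eventually_lt_const hpos).mono
        fun _ h => h.le
    obtain ⟨K, hK, hNK, hθK⟩ := (hsep.and ((eventually_ge_atTop (N + 1)).and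
      (tendsto_natCast_atTop_atTop.eventually_ge_atTop |θ|))).exists
    obtain ⟨x, hx, hlt⟩ := hF K (N + 1) c N.succ_pos hNK hθK ⟨hc.1.le, hc.2.le⟩
      fun q h0 hq => hK q (Finset.mem_Icc.mpr ⟨h0, hq⟩)
    obtain ⟨n, rfl⟩ := hm K x hx
    push_cast at hlt
    refine ⟨_, ⟨n, rfl⟩, ?_⟩
    rw [dist_comm, Real.dist_eq]
    exact (abs_fract_sub_lt hlt hNc.le hNc'.le).trans hNε
  refine Set.Ico_subset_Icc_self.trans ?_
  rw [← closure_Ioo zero_ne_one]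
  exact closure_minimal hIoo isClosed_closure

theorem AlmostReturns.le_card {α : ℕ → ℝ} {K m k : ℕ} (h : AlmostReturns α K m) {ε : ℝ}
    (hk : k ≤ K) (hε : 1 / ((K : ℝ) + 1) ≤ ε) :
    k - 1 ≤ ((Finset.range k).filter (fun i => distToInt ((m : ℝ) * α i) < ε)).card := by
  obtain ⟨j, hj⟩ := h
  calc k - 1 ≤ ((Finset.range k).erase j).card := by
        simpa using Finset.pred_card_le_card_erase (s := Finset.range k) (a := j)
    _ ≤ _ := Finset.card_le_card fun i hi => by
        obtain ⟨hij, hik⟩ := Finset.mem_erase.mp hi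
        have := Finset.mem_range.mp hik
        exact Finset.mem_filter.mpr ⟨hik, (hj i (by lia) hij).trans_le hε⟩

/-- If `(α i)_{i ∈ ℕ}` (here `α i` denotes `α_{i+1}` of the paper) together with `1` form a
family linearly independent over `ℚ`, then there is a strictly increasing sequence `(m n)`
such that: (1) `(m_n θ [1])` is dense in `[0,1)` for every irrational `θ`; (2) for every
`ε > 0` and `k`, eventually `‖m_n α_i‖ < ε` for at least `k - 1` of the indices
`i ∈ {1,…,k}`; (3) for every `k ≥ 2` the set `{n : k ∤ m_n}` is infinite. -/
theorem stmt1 (α : ℕ → ℝ)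
    (hα : LinearIndependent ℚ (fun o : Option ℕ => o.elim (1:ℝ) α)) :
    ∃ m : ℕ → ℕ, StrictMono m ∧
      (∀ θ : ℝ, Irrational θ →
        Set.Ico (0:ℝ) 1 ⊆ closure (Set.range fun n : ℕ => Int.fract ((m n : ℝ) * θ))) ∧
      (∀ ε : ℝ, 0 < ε → ∀ k : ℕ, ∃ N₀ : ℕ, ∀ n ≥ N₀,
        k - 1 ≤ ((Finset.range k).filter
          (fun i => distToInt ((m n : ℝ) * α i) < ε)).card) ∧
      (∀ k : ℕ, 2 ≤ k → {n : ℕ | ¬ (k ∣ m n)}.Infinite) := by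
  choose F hF hone hcover using exists_block hα
  let S : Set ℕ := ⋃ K, (F K : Set ℕ)
  have hS : S.Infinite := Set.infinite_of_forall_exists_gt fun a => by
    obtain ⟨m, hm, hle, -⟩ := hone (a + 1)
    exact ⟨m, Set.mem_iUnion.mpr ⟨_, hm⟩, hle⟩
  let m : ℕ → ℕ := Nat.nth (· ∈ S)
  have hmono : StrictMono m := Nat.nth_strictMono hS
  have hrange : Set.range m = S := Nat.range_nth_of_infinite hS
  have hmem : ∀ K, ∀ x ∈ F K, x ∈ Set.range m := fun K x hx => by
    rw [hrange]
    exact Set.mem_iUnion.mpr ⟨K, hx⟩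
  refine ⟨m, hmono, fun θ hθ => ?_, fun ε hε k => ?_, fun k hk => ?_⟩
  · exact Ico_subset_closure_range_fract hθ hmem fun K N c => hcover K N θ c
  · obtain ⟨K₀, hK₀⟩ := exists_nat_one_div_lt hε
    have hnot : ∀ᶠ n in atTop, ∀ K ∈ Finset.range (max K₀ k), m n ∉ F K :=
      (Finset.eventually_all _).mpr fun K _ => by
        have h := hmono.injective.tendsto_cofinite.eventually (F K).finite_toSet.compl_mem_cofinite
        rwa [Nat.cofinite_eq_atTop] at h
    obtain ⟨N₀, hN₀⟩ := eventually_atTop.mp hnot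
    refine ⟨N₀, fun n hn => ?_⟩
    obtain ⟨K, hK⟩ : ∃ K, m n ∈ F K := by
      have h : m n ∈ S := hrange ▸ Set.mem_range_self n
      exact Set.mem_iUnion.mp h
    have hle : max K₀ k ≤ K := by
      by_contra! hlt
      exact hN₀ n hn K (Finset.mem_range.mpr hlt) hK
    refine (hF K _ hK).le_card ((le_max_right _ _).trans hle) (le_trans ?_ hK₀.le)
    have : (K₀ : ℝ) ≤ K := by exact_mod_cast (le_max_left _ _).trans hle
    gcongr
  · refine Set.Infinite.of_image m (Set.infinite_of_forall_exists_gt fun a => ?_)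
    obtain ⟨x, hx, hle, hmod⟩ := hone (k * (a + 1))
    obtain ⟨n, rfl⟩ := hmem _ x hx
    refine ⟨m n, ⟨n, fun hdvd => ?_, rfl⟩, by nlinarith⟩
    have h1 : k ∣ 1 := (hmod.of_mul_right (a + 1)).dvd_iff dvd_rfl |>.mp hdvd
    have := Nat.le_of_dvd one_pos h1
    lia
end

section
/- Let (α_i)_{i≥1} be real numbers such that the family {1, α_1, α_2, ...} is linearly independent over ℚ, and let (m_n)_{n≥1} be a strictly increasing sequence of natural numbers with the property that for every ε > 0 and every k ∈ ℕ there exists N_0 such that for all n ≥ N_0 the inequality ‖m_n α_i‖ < ε holds for at least k − 1 of the indices i ∈ {1, ..., k}. Then there exists an atomless (continuous) Borel probability measure μ on the circle ℝ/ℤ such that lim_{n→∞} ∫_{ℝ/ℤ} ‖m_n θ‖ dμ(θ) = 0. -/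
open MeasureTheory Filter

/-- The unit interval can be cut repeatedly, one cell at a time (the cell labelled `par t` is cut
at time `t`, and one of its halves is given the new label `t + 1`), so that the measure of the
cells tends uniformly to zero. -/
theorem exists_refining_labels :
    ∃ (par : ℕ → ℕ) (idx : ℕ → unitInterval → ℕ),
      (∀ t, par t ≤ t) ∧ (∀ t, Measurable (idx t)) ∧ (∀ t ω, idx t ω ≤ t) ∧
      (∀ t ω, idx (t + 1) ω = idx t ω ∨ idx (t + 1) ω = t + 1 ∧ idx t ω = par t) ∧
      ∀ ε : ℝ, 0 < ε → ∃ T, ∀ t ≥ T, ∀ i, volume.real {ω | idx t ω = i} ≤ ε := by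
  classical
  let p : ℕ → unitInterval
    | 0 => 0
    | n + 1 => TopologicalSpace.denseSeq unitInterval n
  have hp : DenseRange p := by
    refine (TopologicalSpace.denseRange_denseSeq unitInterval).mono ?_
    rintro _ ⟨n, rfl⟩
    exact ⟨n + 1, rfl⟩
  let idx : ℕ → unitInterval → ℕ := fun t =>
    Nat.rec (motive := fun _ => unitInterval → ℕ) (fun _ => 0)
      (fun (t : ℕ) f ω =>
        if p (t + 1) ≤ ω ∧ p (f ω) < p (t + 1) then t + 1 else f ω) t
  have idx_zero (ω) : idx 0 ω = 0 := rfl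
  have idx_succ (t ω) : idx (t + 1) ω =
    if p (t + 1) ≤ ω ∧ p (idx t ω) < p (t + 1) then t + 1 else idx t ω := rfl
  have idx_le (t ω) : idx t ω ≤ t := by
    induction t with
    | zero => simp [idx_zero]
    | succ t ih => rw [idx_succ]; split_ifs <;> omega
  have p_idx_le (t ω) : p (idx t ω) ≤ ω := by
    induction t with
    | zero => exact unitInterval.nonneg'
    | succ t ih =>
      rw [idx_succ]; split_ifs with h
      exacts [h.1, ih]
  have le_p_idx (t ω) : ∀ s ≤ t, p s ≤ ω → p s ≤ p (idx t ω) := by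
    induction t with
    | zero =>
      intro s hs _
      obtain rfl : s = 0 := by omega
      exact le_rfl
    | succ t ih =>
      intro s hs hsω
      rw [idx_succ]
      rcases Nat.lt_or_ge s (t + 1) with h | h
      · have := ih s (by omega) hsω
        split_ifs with h'
        exacts [this.trans h'.2.le, this]
      · obtain rfl : s = t + 1 := by omega
        split_ifs with h'
        · exact le_rfl
        · exact not_lt.1 fun h'' => h' ⟨hsω, h''⟩
  have idx_eq (t) (q ω : unitInterval) (hq : q ≤ ω) (h : ∀ s ≤ t, p s ≤ ω → p s ≤ q) :
      idx t q = idx t ω := by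
    induction t with
    | zero => rfl
    | succ t ih =>
      have e := ih fun s hs => h s (by omega)
      rw [idx_succ, idx_succ, e]
      have : p (t + 1) ≤ q ↔ p (t + 1) ≤ ω := ⟨fun h' => h'.trans hq, h _ le_rfl⟩
      simp only [this]
  refine ⟨fun t => idx t (p (t + 1)), idx, fun t => idx_le _ _, ?_, idx_le, ?_, ?_⟩
  · intro t
    induction t with
    | zero => exact measurable_const
    | succ t ih =>
      have hs : MeasurableSet {ω | p (t + 1) ≤ ω ∧ p (idx t ω) < p (t + 1)} :=
        measurableSet_Ici.inter (ih (MeasurableSet.of_discrete (s := {i | p i < p (t + 1)})))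
      exact Measurable.ite hs measurable_const ih
  · intro t ω
    rw [idx_succ]
    split_ifs with h
    · exact Or.inr ⟨rfl, (idx_eq t _ _ h.1 fun s hs hsω =>
        (le_p_idx t ω s hs hsω).trans h.2.le).symm⟩
    · exact Or.inl rfl
  · intro ε hε
    obtain ⟨F, hF⟩ := isCompact_univ.elim_finite_subcover
      (fun n => Metric.ball (p n) (ε / 2)) (fun _ => Metric.isOpen_ball) (by
        intro x _
        obtain ⟨n, hn⟩ := hp.exists_dist_lt x (half_pos hε)
        exact Set.mem_iUnion.2 ⟨n, hn⟩)
    have key : ∀ t ≥ F.sup id, ∀ ω ω' : unitInterval, idx t ω = idx t ω' →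
        (ω' : ℝ) - ω ≤ ε := by
      intro t ht ω ω' hidx
      by_contra! hlt
      let c : unitInterval := ⟨((ω : ℝ) + ω') / 2, by
        constructor <;> linarith [ω.2.1, ω.2.2, ω'.2.1, ω'.2.2]⟩
      obtain ⟨n, hn⟩ := Set.mem_iUnion.1 (hF (Set.mem_univ c))
      obtain ⟨hnF, hn⟩ := Set.mem_iUnion.1 hn
      have hd : |((ω : ℝ) + ω') / 2 - p n| < ε / 2 := hn
      rw [abs_lt] at hd
      have h1 : ω < p n := Subtype.coe_lt_coe.1 (by linarith)
      have h2 : p n ≤ ω' := Subtype.coe_le_coe.1 (by linarith)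
      have h3 := le_p_idx t ω' n ((Finset.le_sup (f := id) hnF).trans ht) h2
      rw [← hidx] at h3
      exact absurd (h1.trans_le (h3.trans (p_idx_le t ω))) (lt_irrefl _)
    refine ⟨F.sup id, fun t ht i => ?_⟩
    refine ENNReal.toReal_le_of_le_ofReal hε.le ?_
    rw [unitInterval.volume_apply]
    refine (Real.volume_le_diam _).trans (Metric.ediam_le ?_)
    rintro _ ⟨ω, hω, rfl⟩ _ ⟨ω', hω', rfl⟩
    rw [edist_dist]
    refine ENNReal.ofReal_le_ofReal (abs_sub_le_iff.2 ⟨?_, ?_⟩)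
    · exact key t ht _ _ (hω'.trans hω.symm)
    · exact key t ht _ _ (hω.trans hω'.symm)
theorem norm_nsmul_zsmul_coe_le (m : ℕ) (k : ℤ) (x : ℝ) :
    ‖m • (k • (x : UnitAddCircle))‖ ≤ |(k : ℝ)| * distToInt (m * x) := by
  rw [smul_comm]
  refine (norm_zsmul_le k _).trans (le_of_eq ?_)
  rw [← AddCircle.coe_nsmul, UnitAddCircle.norm_eq, nsmul_eq_mul, distToInt, Int.norm_eq_abs]

/-- If eventually all but one of the `‖m n * α i‖` with `i ≤ t` are small, the same holds for fixed
integer multiples of the `α i`. -/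
theorem exists_forall_norm_nsmul_le {α : ℕ → ℝ} {m : ℕ → ℕ}
    (happrox : ∀ ε : ℝ, 0 < ε → ∀ k : ℕ, ∃ N₀ : ℕ, ∀ n ≥ N₀,
      k - 1 ≤ ((Finset.range k).filter
        (fun i => distToInt ((m n : ℝ) * α i) < ε)).card)
    {x : ℕ → UnitAddCircle} {t : ℕ} (hx : ∀ i ≤ t, ∃ k : ℤ, x i = k • (α i : UnitAddCircle))
    {ε : ℝ} (hε : 0 < ε) :
    ∃ N, ∀ n ≥ N, ∃ i₀, ∀ i ≤ t, i ≠ i₀ → ‖m n • x i‖ ≤ ε := by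
  choose! k hk using hx
  let K : ℝ := ∑ i ∈ Finset.range (t + 1), |(k i : ℝ)| + 1
  have hK : 0 < K := by positivity
  obtain ⟨N, hN⟩ := happrox (ε / K) (by positivity) (t + 1)
  refine ⟨N, fun n hn => ?_⟩
  have hcard := hN n hn
  have hsum := Finset.card_filter_add_card_filter_not (s := Finset.range (t + 1))
    (fun i => distToInt ((m n : ℝ) * α i) < ε / K)
  rw [Finset.card_range] at hsum
  obtain ⟨i₀, hi₀⟩ := Finset.card_le_one_iff_subset_singleton.1
    (show ((Finset.range (t + 1)).filter
      (fun i => ¬ distToInt ((m n : ℝ) * α i) < ε / K)).card ≤ 1 by omega)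
  refine ⟨i₀, fun i hi hne => ?_⟩
  have hlt : distToInt ((m n : ℝ) * α i) < ε / K := by
    by_contra h
    exact hne (Finset.mem_singleton.1 (hi₀ (Finset.mem_filter.2
      ⟨Finset.mem_range.2 (by omega), h⟩)))
  have hkK : |(k i : ℝ)| ≤ K := by
    have := Finset.single_le_sum (f := fun i => |(k i : ℝ)|) (fun _ _ => abs_nonneg _)
      (Finset.mem_range.2 (Nat.lt_succ_of_le hi))
    exact this.trans (by simp [K])
  rw [hk i hi]
  calc _ ≤ |(k i : ℝ)| * distToInt (m n * α i) := norm_nsmul_zsmul_coe_le _ _ _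
    _ ≤ K * (ε / K) := by gcongr; exact abs_nonneg _
    _ = ε := by field_simp

/-- The points chosen up to time `t`, together with a time `N` after which all but one of them are
nearly killed by `m n`, and a radius `r` that is negligible up to time `N`. -/
structure IsApproxStage (α : ℕ → ℝ) (m : ℕ → ℕ) (t : ℕ) (x : ℕ → UnitAddCircle) (N : ℕ) (r : ℝ) :
    Prop where
  pos : 0 < r
  separated : ∀ i ≤ t, ∀ j ≤ t, i ≠ j → 4 * r < dist (x i) (x j)
  mul_le : ∀ n ≤ N, (m n : ℝ) * (2 * r) ≤ 1 / (t + 1)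
  norm_le : ∀ n ≥ N, ∃ i₀, ∀ i ≤ t, i ≠ i₀ → ‖m n • x i‖ ≤ 1 / (t + 1)
  zsmul : ∀ i ≤ t, ∃ k : ℤ, x i = k • (α i : UnitAddCircle)

theorem exists_isApproxStage {α : ℕ → ℝ} {m : ℕ → ℕ}
    (happrox : ∀ ε : ℝ, 0 < ε → ∀ k : ℕ, ∃ N₀ : ℕ, ∀ n ≥ N₀,
      k - 1 ≤ ((Finset.range k).filter
        (fun i => distToInt ((m n : ℝ) * α i) < ε)).card)
    {x : ℕ → UnitAddCircle} {t : ℕ} (hx : ∀ i ≤ t, ∃ k : ℤ, x i = k • (α i : UnitAddCircle))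
    (hinj : ∀ i ≤ t, ∀ j ≤ t, i ≠ j → x i ≠ x j) (N₀ : ℕ) {r₀ : ℝ} (hr₀ : 0 < r₀) :
    ∃ N r, N₀ ≤ N ∧ r ≤ r₀ ∧ IsApproxStage α m t x N r := by
  obtain ⟨N, hN⟩ := exists_forall_norm_nsmul_le happrox hx (ε := 1 / (t + 1)) (by positivity)
  have hev : ∀ᶠ r : ℝ in nhdsWithin 0 (Set.Ioi 0), r ≤ r₀ ∧ 0 < r ∧
      (∀ i ∈ Set.Iic t, ∀ j ∈ Set.Iic t, i ≠ j → 4 * r < dist (x i) (x j)) ∧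
      ∀ n ∈ Set.Iic (max N₀ N), (m n : ℝ) * (2 * r) ≤ 1 / (t + 1) := by
    refine Eventually.and (nhdsWithin_le_nhds (eventually_le_nhds hr₀))
      (Eventually.and self_mem_nhdsWithin (nhdsWithin_le_nhds (Eventually.and ?_ ?_)))
    · rw [eventually_all_finite (Set.finite_Iic t)]
      intro i hi
      rw [eventually_all_finite (Set.finite_Iic t)]
      intro j hj
      by_cases hij : i = j
      · simp [hij]
      · have h : Tendsto (fun r : ℝ => 4 * r) (nhds 0) (nhds 0) := by
          simpa using (continuous_const_mul (4 : ℝ)).tendsto 0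
        filter_upwards [h.eventually_lt_const (dist_pos.2 (hinj i hi j hj hij))] with r hr _
        exact hr
    · rw [eventually_all_finite (Set.finite_Iic _)]
      intro n _
      have h : Tendsto (fun r : ℝ => (m n : ℝ) * (2 * r)) (nhds 0) (nhds 0) := by
        have : Continuous fun r : ℝ => (m n : ℝ) * (2 * r) := by fun_prop
        simpa using this.tendsto 0
      exact h.eventually_le_const (by positivity)
  obtain ⟨r, h1, h2, h3, h4⟩ := hev.exists
  exact ⟨max N₀ N, r, le_max_left _ _, h1, h2, h3, h4,
    fun n hn => hN n ((le_max_right _ _).trans hn), hx⟩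

theorem IsApproxStage.exists_succ {α : ℕ → ℝ} {m : ℕ → ℕ}
    (hα : ∀ i, Irrational (α i))
    (happrox : ∀ ε : ℝ, 0 < ε → ∀ k : ℕ, ∃ N₀ : ℕ, ∀ n ≥ N₀,
      k - 1 ≤ ((Finset.range k).filter
        (fun i => distToInt ((m n : ℝ) * α i) < ε)).card)
    {t : ℕ} {x : ℕ → UnitAddCircle} {N : ℕ} {r : ℝ} (h : IsApproxStage α m t x N r) (j : ℕ) :
    ∃ x' N' r', IsApproxStage α m (t + 1) x' N' r' ∧ (∀ i ≤ t, x' i = x i) ∧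
      dist (x j) (x' (t + 1)) ≤ r ∧ r' ≤ r / 2 ∧ N + 1 ≤ N' := by
  have hd : DenseRange (· • (α (t + 1) : UnitAddCircle) : ℤ → UnitAddCircle) :=
    AddCircle.denseRange_zsmul_coe_iff.2 (by simpa using hα (t + 1))
  have : Nontrivial UnitAddCircle := ⟨((2⁻¹ : ℝ) : UnitAddCircle), 0, fun e => by
    have h := AddCircle.norm_half_period_eq 1
    rw [one_div, e, norm_zero] at h
    norm_num at h⟩
  have hd' := Dense.sdiff_finite hd ((Set.finite_Iic t).image x)
  obtain ⟨_, ⟨⟨k, rfl⟩, hk⟩, hr⟩ := hd'.exists_dist_lt (x j) h.pos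
  let y : UnitAddCircle := k • (α (t + 1) : UnitAddCircle)
  have hy : ∀ i ≤ t, x i ≠ y := fun i hi e => hk ⟨i, hi, e⟩
  have hx' : ∀ i ≤ t, Function.update x (t + 1) y i = x i := fun i hi =>
    Function.update_of_ne (by omega) _ _
  have hxt : Function.update x (t + 1) y (t + 1) = y := Function.update_self _ _ _
  have hle : ∀ i ≤ t + 1, i ≤ t ∨ i = t + 1 := fun i hi => by omega
  have hinj : ∀ i ≤ t, ∀ j ≤ t, i ≠ j → x i ≠ x j := fun i hi j hj hij =>
    dist_pos.1 ((by linarith [h.pos] : (0 : ℝ) < 4 * r).trans (h.separated i hi j hj hij))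
  obtain ⟨N', r', hN', hr', h'⟩ := exists_isApproxStage happrox
    (x := Function.update x (t + 1) y) (t := t + 1) (by
      intro i hi
      rcases hle i hi with hi | rfl
      · rw [hx' i hi]; exact h.zsmul i hi
      · exact ⟨k, hxt⟩)
    (by
      intro i hi j hj hij
      rcases hle i hi with hi | rfl <;> rcases hle j hj with hj | rfl
      · rw [hx' i hi, hx' j hj]; exact hinj i hi j hj hij
      · rw [hx' i hi, hxt]; exact hy i hi
      · rw [hx' j hj, hxt]; exact (hy j hj).symm
      · exact absurd rfl hij) (N + 1) (half_pos h.pos)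
  exact ⟨_, N', r', h', hx', by rw [hxt]; exact hr.le, hr', hN'⟩

/-- A compatible sequence of stages, in which the point created at time `t + 1` is close to the
point with label `par t`. -/
theorem exists_seq_isApproxStage {α : ℕ → ℝ} {m : ℕ → ℕ}
    (hα : ∀ i, Irrational (α i))
    (happrox : ∀ ε : ℝ, 0 < ε → ∀ k : ℕ, ∃ N₀ : ℕ, ∀ n ≥ N₀,
      k - 1 ≤ ((Finset.range k).filter
        (fun i => distToInt ((m n : ℝ) * α i) < ε)).card)
    {par : ℕ → ℕ} (hpar : ∀ t, par t ≤ t) :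
    ∃ (x : ℕ → UnitAddCircle) (N : ℕ → ℕ) (r : ℕ → ℝ),
      (∀ t, IsApproxStage α m t x (N t) (r t)) ∧ (∀ t, dist (x (par t)) (x (t + 1)) ≤ r t) ∧
      (∀ t, r (t + 1) ≤ r t / 2) ∧ StrictMono N := by
  let S (t : ℕ) := {s : (ℕ → UnitAddCircle) × ℕ × ℝ // IsApproxStage α m t s.1 s.2.1 s.2.2}
  obtain ⟨N₀, r₀, -, -, h₀⟩ := exists_isApproxStage (t := 0) happrox
    (x := fun i => (α i : UnitAddCircle)) (fun i _ => ⟨1, (one_smul ℤ _).symm⟩)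
    (fun i hi j hj hij => absurd (by omega) hij) 0 one_pos
  have step (t : ℕ) (s : S t) : ∃ s' : S (t + 1), (∀ i ≤ t, s'.1.1 i = s.1.1 i) ∧
      dist (s.1.1 (par t)) (s'.1.1 (t + 1)) ≤ s.1.2.2 ∧ s'.1.2.2 ≤ s.1.2.2 / 2 ∧
      s.1.2.1 + 1 ≤ s'.1.2.1 := by
    obtain ⟨x', N', r', h', h⟩ := s.2.exists_succ hα happrox (par t)
    exact ⟨⟨(x', N', r'), h'⟩, h⟩
  choose f hf hd hr hN using step
  let s (t : ℕ) : S t := Nat.rec ⟨(_, N₀, r₀), h₀⟩ f t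
  have hs (t) : s (t + 1) = f t (s t) := rfl
  have hx (i d : ℕ) : (s (i + d)).1.1 i = (s i).1.1 i := by
    induction d with
    | zero => rfl
    | succ d ih => rw [← ih, ← add_assoc, hs]; exact hf _ _ i (by omega)
  have hx' (i t : ℕ) (h : i ≤ t) : (s t).1.1 i = (s i).1.1 i := by
    obtain ⟨d, rfl⟩ := Nat.exists_eq_add_of_le h
    exact hx i d
  refine ⟨fun i => (s i).1.1 i, fun t => (s t).1.2.1, fun t => (s t).1.2.2, fun t => ?_,
    fun t => ?_, fun t => hr t (s t), strictMono_nat_of_lt_succ fun t => hN t (s t)⟩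
  · have h := (s t).2
    refine ⟨h.pos, fun i hi j hj => ?_, h.mul_le, fun n hn => ?_, fun i hi => ?_⟩
    · rw [← hx' i t hi, ← hx' j t hj]; exact h.separated i hi j hj
    · obtain ⟨i₀, hi₀⟩ := h.norm_le n hn
      exact ⟨i₀, fun i hi => by rw [← hx' i t hi]; exact hi₀ i hi⟩
    · rw [← hx' i t hi]; exact h.zsmul i hi
  · have := hd t (s t)
    rwa [hx' _ _ (hpar t), ← hs] at this
/-- Limits along refining labels: the labels select points `x (idx t ω)` which converge as `t` grows,
since consecutive selected points are at geometrically decreasing distance. -/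
theorem exists_measurable_limit {X : Type*} [MetricSpace X] [CompleteSpace X] [MeasurableSpace X]
    [BorelSpace X] {Ω : Type*} [MeasurableSpace Ω] {par : ℕ → ℕ} {idx : ℕ → Ω → ℕ}
    (hmeas : ∀ t, Measurable (idx t))
    (hstep : ∀ t ω, idx (t + 1) ω = idx t ω ∨ idx (t + 1) ω = t + 1 ∧ idx t ω = par t)
    {x : ℕ → X} {r : ℕ → ℝ} (hpos : ∀ t, 0 < r t)
    (hd : ∀ t, dist (x (par t)) (x (t + 1)) ≤ r t) (hr : ∀ t, r (t + 1) ≤ r t / 2) :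
    ∃ φ : Ω → X, Measurable φ ∧ ∀ t ω, dist (x (idx t ω)) (φ ω) ≤ 2 * r t := by
  have hdist (t ω) : dist (x (idx t ω)) (x (idx (t + 1) ω)) ≤ r t := by
    rcases hstep t ω with h | ⟨h, h'⟩
    · rw [h, dist_self]; exact (hpos t).le
    · rw [h, h']; exact hd t
  have hgeom (t) : r t ≤ 2 * r 0 / 2 / 2 ^ t := by
    induction t with
    | zero => simp
    | succ t ih =>
      refine (hr t).trans ?_
      rw [pow_succ, ← div_div]
      linarith
  have hcauchy (ω) : CauchySeq fun t => x (idx t ω) :=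
    cauchySeq_of_le_geometric_two fun t => (hdist t ω).trans (hgeom t)
  choose φ hφ using fun ω => cauchySeq_tendsto_of_complete (hcauchy ω)
  refine ⟨φ, measurable_of_tendsto_metrizable
    (fun t => (Measurable.of_discrete (f := x)).comp (hmeas t)) (tendsto_pi_nhds.2 hφ),
    fun t ω => ?_⟩
  have hsum (d : ℕ) :
      dist (x (idx t ω)) (x (idx (t + d) ω)) ≤ 2 * r t - 2 * r (t + d) := by
    induction d with
    | zero => simp
    | succ d ih =>
      have h1 := dist_triangle (x (idx t ω)) (x (idx (t + d) ω)) (x (idx (t + (d + 1)) ω))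
      have h2 : _ ≤ _ := hdist (t + d) ω
      have h3 : _ ≤ _ := hr (t + d)
      rw [← add_assoc] at *
      linarith
  refine le_of_tendsto (tendsto_const_nhds.dist (hφ ω))
    (eventually_atTop.2 ⟨t, fun s hs => ?_⟩)
  obtain ⟨d, rfl⟩ := Nat.exists_eq_add_of_le hs
  linarith [hsum d, hpos (t + d)]

/-- If `{1, α_1, α_2, …}` is linearly independent over `ℚ` (with `α i` denoting `α_{i+1}`)
and `(m n)` is a strictly increasing sequence of naturals such that for every `ε > 0` and
every `k` eventually `‖m_n α_i‖ < ε` for at least `k - 1` of the indices `i ∈ {1,…,k}`,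
then there is an atomless Borel probability measure `μ` on the circle with
`∫ ‖m_n θ‖ dμ(θ) → 0`. -/
theorem stmt2 (α : ℕ → ℝ)
    (hα : LinearIndependent ℚ (fun o : Option ℕ => o.elim (1:ℝ) α))
    (m : ℕ → ℕ) (hm : StrictMono m)
    (happrox : ∀ ε : ℝ, 0 < ε → ∀ k : ℕ, ∃ N₀ : ℕ, ∀ n ≥ N₀,
      k - 1 ≤ ((Finset.range k).filter
        (fun i => distToInt ((m n : ℝ) * α i) < ε)).card) :
    ∃ μ : Measure UnitAddCircle, IsProbabilityMeasure μ ∧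
      (∀ x : UnitAddCircle, μ {x} = 0) ∧
      Tendsto (fun n : ℕ => ∫ θ : UnitAddCircle, ‖(m n) • θ‖ ∂μ) atTop (nhds 0) := by
  have hirr (i : ℕ) : Irrational (α i) := by
    rintro ⟨q, hq⟩
    have h := linearIndependent_iff'.1 hα {some i, none} (fun o => o.elim (-q) fun _ => 1)
      (by simp [← hq, Rat.smul_def]) (some i) (by simp)
    exact one_ne_zero h
  obtain ⟨par, idx, hpar, hmeas, hidx, hstep, hsmall⟩ := exists_refining_labels
  obtain ⟨x, N, r, hstage, hd, hr, hN⟩ := exists_seq_isApproxStage hirr happrox hpar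
  obtain ⟨φ, hφ, hdist⟩ := exists_measurable_limit hmeas hstep (fun t => (hstage t).pos) hd hr
  refine ⟨Measure.map φ volume, Measure.isProbabilityMeasure_map hφ.aemeasurable, fun y => ?_, ?_⟩
  · rw [Measure.map_apply hφ (measurableSet_singleton y), ← measureReal_eq_zero_iff]
    refine le_antisymm (le_of_forall_pos_le_add fun ε hε => ?_) measureReal_nonneg
    obtain ⟨T, hT⟩ := hsmall ε hε
    rcases (φ ⁻¹' {y}).eq_empty_or_nonempty with he | ⟨ω₀, hω₀⟩
    · rw [he]; simpa using hε.le
    · refine (measureReal_mono fun ω hω => ?_).trans ((hT T le_rfl (idx T ω₀)).trans (by simp))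
      by_contra hne
      have h1 := (hstage T).separated _ (hidx T ω) _ (hidx T ω₀) hne
      have h2 := hdist T ω
      have h3 := hdist T ω₀
      rw [show φ ω = y from hω] at h2
      rw [show φ ω₀ = y from hω₀] at h3
      linarith [dist_triangle_right (x (idx T ω)) (x (idx T ω₀)) y]
  · rw [Metric.tendsto_atTop]
    intro ε hε
    obtain ⟨T, hT⟩ := hsmall (ε / 8) (by positivity)
    obtain ⟨T', hT'⟩ := exists_nat_one_div_lt (show 0 < ε / 8 by positivity)
    refine ⟨N (max T T'), fun n hn => ?_⟩
    have hex : ∃ t, n < N t := ⟨n + 1, hN.le_apply (x := n + 1)⟩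
    obtain ⟨t, ht⟩ : ∃ t, Nat.find hex = t + 1 := by
      refine Nat.exists_eq_succ_of_ne_zero fun h0 => ?_
      have := Nat.find_spec hex
      rw [h0] at this
      have := hN.monotone (Nat.zero_le (max T T'))
      omega
    have hlt : n < N (t + 1) := ht ▸ Nat.find_spec hex
    have hge : N t ≤ n := not_lt.1 (Nat.find_min hex (by omega))
    have hmax : max T T' ≤ t := by
      have : max T T' < t + 1 := hN.lt_iff_lt.1 (hn.trans_lt hlt)
      omega
    have ht8 : 1 / ((t : ℝ) + 1) < ε / 8 := by
      refine lt_of_le_of_lt ?_ hT'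
      have : (T' : ℝ) ≤ t := by exact_mod_cast (le_max_right _ _).trans hmax
      gcongr
    obtain ⟨i₀, hi₀⟩ := (hstage t).norm_le n hge
    have hpt (ω) : ‖m n • φ ω‖ ≤ ε / 4 + ({ω | idx (t + 1) ω = t + 1}.indicator 1 ω +
        {ω | idx (t + 1) ω = i₀}.indicator 1 ω) := by
      have hnorm : ‖m n • φ ω‖ ≤ 1 := by
        have := AddCircle.norm_le_half_period (x := m n • φ ω) 1 one_ne_zero
        norm_num at this
        linarith
      have hind (s : Set unitInterval) : 0 ≤ s.indicator (1 : unitInterval → ℝ) ω :=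
        Set.indicator_nonneg (fun _ _ => zero_le_one) _
      by_cases h1 : idx (t + 1) ω = t + 1
      · have : {ω | idx (t + 1) ω = t + 1}.indicator (1 : unitInterval → ℝ) ω = 1 :=
          Set.indicator_of_mem (s := {ω | idx (t + 1) ω = t + 1}) h1 _
        linarith [hind {ω | idx (t + 1) ω = i₀}]
      by_cases h2 : idx (t + 1) ω = i₀
      · have : {ω | idx (t + 1) ω = i₀}.indicator (1 : unitInterval → ℝ) ω = 1 :=
          Set.indicator_of_mem (s := {ω | idx (t + 1) ω = i₀}) h2 _
        linarith [hind {ω | idx (t + 1) ω = t + 1}]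
      have h3 := hi₀ (idx (t + 1) ω) (by have := hidx (t + 1) ω; omega) h2
      have h4 : ‖m n • φ ω - m n • x (idx (t + 1) ω)‖ ≤ 1 / ((t : ℝ) + 1) := by
        rw [← smul_sub]
        calc _ ≤ (m n : ℝ) * ‖φ ω - x (idx (t + 1) ω)‖ := norm_nsmul_le
          _ ≤ (m n : ℝ) * (2 * r (t + 1)) := by
            gcongr
            rw [← dist_eq_norm, dist_comm]
            exact hdist _ _
          _ ≤ 1 / ((t + 1 : ℕ) + 1) := (hstage (t + 1)).mul_le n hlt.le
          _ ≤ 1 / ((t : ℝ) + 1) := by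
            push_cast
            gcongr
            linarith
      have h5 := norm_le_norm_add_norm_sub' (m n • φ ω) (m n • x (idx (t + 1) ω))
      linarith [hind {ω | idx (t + 1) ω = i₀}, hind {ω | idx (t + 1) ω = t + 1}]
    have hset (i : ℕ) : MeasurableSet {ω | idx (t + 1) ω = i} :=
      hmeas (t + 1) (measurableSet_singleton i)
    have hint (i : ℕ) : Integrable ({ω | idx (t + 1) ω = i}.indicator (1 : unitInterval → ℝ)) :=
      (integrable_const (1 : ℝ)).indicator (hset i)
    have hle : ∫ ω, ‖m n • φ ω‖ ≤ ε / 4 + (ε / 8 + ε / 8) := by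
      refine (integral_mono_of_nonneg (ae_of_all _ fun _ => norm_nonneg _)
        ((integrable_const _).add ((hint _).add (hint _))) (ae_of_all _ hpt)).trans ?_
      rw [integral_add' (integrable_const _) ((hint _).add (hint _)),
        integral_add' (hint _) (hint _), integral_indicator_one (hset _),
        integral_indicator_one (hset _)]
      have htT : T ≤ t + 1 := (le_max_left _ _).trans (hmax.trans t.le_succ)
      simpa using add_le_add (hT _ htT (t + 1)) (hT _ htT i₀)
    rw [integral_map hφ.aemeasurable (by fun_prop), Real.dist_0_eq_abs,
      abs_of_nonneg (integral_nonneg fun _ => norm_nonneg _)]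
    linarith
end

section
/- Let (α_i)_{i≥1} be real numbers such that the family {1, α_1, α_2, ...} is linearly independent over ℚ. Then there exists a strictly increasing sequence of natural numbers (s_n)_{n≥1} such that lim_{n→∞} ‖s_n α_i‖ = 0 for every i ∈ ℕ, and such that for every real number θ, the sequence of fractional parts (s_n θ [1])_{n≥1} is dense in [0,1) if and only if θ does not belong to ⋃_{n≥1} (ℚ + ℚα_1 + ⋯ + ℚα_n), i.e. θ is not a finite ℚ-linear combination of 1, α_1, α_2, .... -/
open Filter

theorem tendsto_average_geom (q : Circle) (hq : q ≠ 1) :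
    Tendsto (fun L : ℕ => ((L : ℂ))⁻¹ * ∑ m ∈ Finset.range L, (q : ℂ) ^ m) atTop (nhds 0) := by
  have hq' : (q : ℂ) - 1 ≠ 0 := by
    rwa [sub_ne_zero, Ne, Circle.coe_eq_one]
  have h0 : Tendsto (fun L : ℕ => ((L : ℂ))⁻¹) atTop (nhds 0) :=
    tendsto_inv_atTop_nhds_zero_nat (𝕜 := ℂ)
  refine h0.zero_mul_isBoundedUnder_le
    (isBoundedUnder_of ⟨2 / ‖(q : ℂ) - 1‖, fun L => ?_⟩)
  simp only [Function.comp]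
  rw [geom_sum_eq (sub_ne_zero.mp hq'), norm_div]
  gcongr
  calc _ ≤ ‖(q : ℂ) ^ L‖ + ‖(1 : ℂ)‖ := norm_sub_le _ _
    _ = 2 := by rw [norm_pow, Circle.norm_coe]; norm_num

theorem tendsto_average_norm_sq {ι : Type*} [Fintype ι] (z : ι → Circle)
    (hz : Function.Injective z) (c : ι → ℂ) :
    Tendsto (fun L : ℕ => ((L : ℝ))⁻¹ * ∑ m ∈ Finset.range L, ‖∑ i, c i * (z i : ℂ) ^ m‖ ^ 2)
      atTop (nhds (∑ i, ‖c i‖ ^ 2)) := by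
  classical
  rw [← tendsto_ofReal_iff]
  have key : ∀ L : ℕ, ((((L : ℝ))⁻¹ * ∑ m ∈ Finset.range L, ‖∑ i, c i * (z i : ℂ) ^ m‖ ^ 2 : ℝ) : ℂ)
      = ∑ i, ∑ j, c i * (starRingEnd ℂ) (c j) *
        ((L : ℂ)⁻¹ * ∑ m ∈ Finset.range L, ((z i / z j : Circle) : ℂ) ^ m) := by
    intro L
    push_cast
    simp_rw [← Complex.mul_conj', map_sum, Finset.sum_mul_sum, Finset.mul_sum]
    rw [Finset.sum_comm]
    refine Finset.sum_congr rfl fun i _ => ?_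
    rw [Finset.sum_comm]
    refine Finset.sum_congr rfl fun j _ => Finset.sum_congr rfl fun m _ => ?_
    have : (starRingEnd ℂ) (z j : ℂ) = ((z j : ℂ))⁻¹ := by
      rw [← Circle.coe_inv_eq_conj, Circle.coe_inv]
    simp only [map_mul, map_pow, this, div_eq_mul_inv, mul_pow]
    ring
  have hlim : ((∑ i, ‖c i‖ ^ 2 : ℝ) : ℂ)
      = ∑ i, ∑ j, c i * (starRingEnd ℂ) (c j) * (if i = j then 1 else 0) := by
    simp [Complex.mul_conj']
  rw [hlim]
  refine Tendsto.congr (fun L => (key L).symm) ?_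
  refine tendsto_finsetSum _ fun i _ => tendsto_finsetSum _ fun j _ => Tendsto.const_mul _ ?_
  split_ifs with h
  · subst h
    refine tendsto_const_nhds.congr' ?_
    filter_upwards [eventually_gt_atTop 0] with L hL
    have : (L : ℂ) ≠ 0 := by exact_mod_cast hL.ne'
    simp [this]
  · exact tendsto_average_geom _ (by rw [Ne, div_eq_one]; exact fun h' => h (hz h'))

theorem exists_norm_sq_ge {ι : Type*} [Fintype ι] (z : ι → Circle)
    (hz : Function.Injective z) (c : ι → ℂ) (hc : 0 < ∑ i, ‖c i‖ ^ 2) (M : ℕ) :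
    ∃ m ≥ M, (∑ i, ‖c i‖ ^ 2) / 2 < ‖∑ i, c i * (z i : ℂ) ^ m‖ ^ 2 := by
  have h := tendsto_average_norm_sq z hz (fun i => c i * (z i : ℂ) ^ M)
  simp only [norm_mul, norm_pow, Circle.norm_coe, one_pow, mul_one] at h
  by_contra! hcon
  refine absurd (le_of_tendsto' h (b := (∑ i, ‖c i‖ ^ 2) / 2) fun L => ?_) (by linarith)
  rcases Nat.eq_zero_or_pos L with rfl | hL
  · simp; positivity
  rw [inv_mul_le_iff₀ (by exact_mod_cast hL)]
  refine (Finset.sum_le_card_nsmul (Finset.range L) _ _ fun m _ => ?_).trans_eq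
    (by rw [Finset.card_range, nsmul_eq_mul])
  simpa only [mul_assoc, ← pow_add] using hcon (M + m) (by omega)

theorem exists_forall_norm_one_add_gt {J : Type*} [Fintype J] [DecidableEq J] {η : ℝ} (hη : 0 ≤ η)
    (hη1 : η ≤ 1) {N : ℕ} (hN : η ^ N * (2 * (N + 1) ^ Fintype.card J) < 1) (w u : J → Circle)
    (hu : Function.Injective fun a : J → Fin (N + 1) => ∏ j, u j ^ (a j : ℕ)) (M : ℕ) :
    ∃ m ≥ M, ∀ j, 2 * η < ‖1 + (w j : ℂ) * (u j : ℂ) ^ m‖ := by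
  set c : (J → Fin (N + 1)) → ℂ :=
    fun a => ∏ j, ((N.choose (a j) : ℂ) / 2 ^ N * (w j : ℂ) ^ (a j : ℕ)) with hc
  have hsum : ∀ v : J → ℂ, ∏ j, ((1 + v j) / 2) ^ N
      = ∑ a : J → Fin (N + 1), ∏ j, ((N.choose (a j) : ℂ) / 2 ^ N * v j ^ (a j : ℕ)) := by
    intro v
    rw [← Fintype.prod_sum fun (j : J) (a : Fin (N + 1)) =>
      (N.choose a : ℂ) / 2 ^ N * v j ^ (a : ℕ)]
    refine Finset.prod_congr rfl fun j _ => ?_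
    rw [div_pow, add_comm, add_pow, Finset.sum_div, ← Fin.sum_univ_eq_sum_range
      (fun a => v j ^ a * 1 ^ (N - a) * (N.choose a : ℂ) / 2 ^ N)]
    exact Finset.sum_congr rfl fun a _ => by simp; ring
  have hnorm : ∑ a, ‖c a‖ = 1 := by
    have h := hsum 1
    have h1 : ∀ a, ((‖c a‖ : ℝ) : ℂ) = ∏ j, ((N.choose (a j) : ℂ) / 2 ^ N * (1 : J → ℂ) j ^ (a j : ℕ)) := by
      intro a
      simp [hc, Circle.norm_coe]
    simp_rw [← h1] at h
    norm_num at h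
    exact_mod_cast h.symm
  have hcs : 1 ≤ ((N : ℝ) + 1) ^ Fintype.card J * ∑ a, ‖c a‖ ^ 2 := by
    have h := sq_sum_le_card_mul_sum_sq (s := Finset.univ) (f := fun a => ‖c a‖)
    rw [hnorm] at h
    simpa using h
  have hNJ : (0 : ℝ) < ((N : ℝ) + 1) ^ Fintype.card J := by positivity
  have hpos : 0 < ∑ a, ‖c a‖ ^ 2 := by
    by_contra! hle
    nlinarith
  obtain ⟨m, hmM, hm⟩ := exists_norm_sq_ge _ hu c hpos M
  refine ⟨m, hmM, fun j => ?_⟩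
  by_contra! hj
  have hprod : ∑ a, c a * ((∏ j, u j ^ (a j : ℕ) : Circle) : ℂ) ^ m
      = ∏ j, ((1 + (w j : ℂ) * (u j : ℂ) ^ m) / 2) ^ N := by
    rw [hsum]
    refine Finset.sum_congr rfl fun a _ => ?_
    have : ((∏ j, u j ^ (a j : ℕ) : Circle) : ℂ) = ∏ j, (u j : ℂ) ^ (a j : ℕ) := by
      exact map_prod Circle.coeHom (fun j => u j ^ (a j : ℕ)) Finset.univ
    rw [this, hc, ← Finset.prod_pow, ← Finset.prod_mul_distrib]
    exact Finset.prod_congr rfl fun j _ => by ring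
  rw [hprod] at hm
  have hle : ‖∏ j, ((1 + (w j : ℂ) * (u j : ℂ) ^ m) / 2) ^ N‖ ≤ η ^ N := by
    rw [norm_prod, ← Finset.mul_prod_erase _ _ (Finset.mem_univ j), ← mul_one (η ^ N)]
    refine mul_le_mul ?_ (Finset.prod_le_one (fun _ _ => norm_nonneg _) fun i _ => ?_)
      (Finset.prod_nonneg fun _ _ => norm_nonneg _) (by positivity)
    · rw [norm_pow, norm_div]
      gcongr
      rw [Complex.norm_ofNat]
      linarith
    · rw [norm_pow, norm_div, Complex.norm_ofNat]
      refine pow_le_one₀ (by positivity) ?_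
      have : ‖1 + (w i : ℂ) * (u i : ℂ) ^ m‖ ≤ ‖(1 : ℂ)‖ + ‖(w i : ℂ) * (u i : ℂ) ^ m‖ :=
        norm_add_le _ _
      simp only [norm_one, norm_mul, norm_pow, Circle.norm_coe, one_pow, mul_one] at this
      linarith
  have hηN : η ^ N ≤ 1 := pow_le_one₀ hη hη1
  have hηN0 : 0 ≤ η ^ N := by positivity
  have : ‖∏ j, ((1 + (w j : ℂ) * (u j : ℂ) ^ m) / 2) ^ N‖ ^ 2 ≤ η ^ N := by
    calc _ ≤ (η ^ N) ^ 2 := by gcongr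
      _ ≤ η ^ N := by nlinarith
  nlinarith

theorem exists_pow_mul_lt_one {η : ℝ} (hη : 0 ≤ η) (hη1 : η < 1) (d : ℕ) :
    ∃ N : ℕ, η ^ N * (2 * ((N : ℝ) + 1) ^ d) < 1 := by
  have h := tendsto_pow_const_mul_const_pow_of_abs_lt_one d (r := η) (by rwa [abs_of_nonneg hη])
  have h2 : Tendsto (fun n : ℕ => 2 * 2 ^ d * ((n : ℝ) ^ d * η ^ n)) atTop (nhds 0) := by
    simpa using h.const_mul (2 * 2 ^ d)
  obtain ⟨N, hN, hN1⟩ := ((h2.eventually_lt_const one_pos).and (eventually_ge_atTop 1)).exists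
  refine ⟨N, lt_of_le_of_lt ?_ hN⟩
  have : ((N : ℝ) + 1) ^ d ≤ 2 ^ d * (N : ℝ) ^ d := by
    rw [← mul_pow]
    gcongr
    have : (1 : ℝ) ≤ N := by exact_mod_cast hN1
    linarith
  calc _ ≤ η ^ N * (2 * (2 ^ d * (N : ℝ) ^ d)) := by gcongr
    _ = _ := by ring

/-- Uniform Kronecker theorem: the degree `N` depends only on the dimension and on `ε`. -/
theorem exists_degree_forall_dist_lt (J : Type*) [Fintype J] [DecidableEq J] {ε : ℝ} (hε : 0 < ε) :
    ∃ N : ℕ, ∀ w u : J → Circle,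
      (Function.Injective fun a : J → Fin (N + 1) => ∏ j, u j ^ (a j : ℕ)) →
      ∀ M : ℕ, ∃ m ≥ M, ∀ j, dist (u j ^ m) (w j) < ε := by
  set η : ℝ := √(1 - (min ε 1) ^ 2 / 4)
  have hmin : 0 < min ε 1 := lt_min hε one_pos
  have hsq : η ^ 2 = 1 - (min ε 1) ^ 2 / 4 :=
    Real.sq_sqrt (by nlinarith [min_le_right ε 1])
  have hη0 : 0 ≤ η := Real.sqrt_nonneg _
  have hη1 : η < 1 := by nlinarith [pow_pos hmin 2]
  obtain ⟨N, hN⟩ := exists_pow_mul_lt_one hη0 hη1 (Fintype.card J)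
  refine ⟨N, fun w u hu M => ?_⟩
  obtain ⟨m, hm, h⟩ := exists_forall_norm_one_add_gt hη0 hη1.le hN w⁻¹ u hu M
  refine ⟨m, hm, fun j => lt_of_lt_of_le ?_ (min_le_left ε 1)⟩
  have hj := h j
  set v : ℂ := ((w⁻¹) j : ℂ) * (u j : ℂ) ^ m with hv
  have hv1 : ‖v‖ = 1 := by simp [hv, Circle.norm_coe]
  have hpar := parallelogram_law_with_norm ℝ (1 : ℂ) v
  have hdist : dist (u j ^ m) (w j) = ‖1 - v‖ := by
    have : (1 : ℂ) - v = ((w⁻¹) j : ℂ) * (w j - (u j : ℂ) ^ m) := by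
      simp [hv, mul_sub]
    rw [this, norm_mul, Circle.norm_coe, one_mul, ← Circle.coe_pow, norm_sub_rev]
    exact dist_eq_norm (u j ^ m : ℂ) (w j : ℂ)
  rw [hdist]
  rw [hv1, norm_one] at hpar
  refine lt_of_pow_lt_pow_left₀ 2 hmin.le ?_
  nlinarith

/-- The points of the circle satisfying a multiplicative relation of degree at most `N`
with the family `z` in which they genuinely occur. -/
def resonantSet {J : Type*} [Fintype J] (z : J → Circle) (N : ℕ) : Set Circle :=
  {u | ∃ a a' : J → Fin (N + 1), ∃ b b' : Fin (N + 1), b ≠ b' ∧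
    (∏ i, z i ^ (a i : ℕ)) * u ^ (b : ℕ) = (∏ i, z i ^ (a' i : ℕ)) * u ^ (b' : ℕ)}

open Polynomial in
theorem Circle.finite_setOf_mul_pow_eq (x y : Circle) {b b' : ℕ} (h : b ≠ b') :
    {u : Circle | x * u ^ b = y * u ^ b'}.Finite := by
  set p : ℂ[X] := C (x : ℂ) * X ^ b - C (y : ℂ) * X ^ b' with hp
  have hp0 : p ≠ 0 := by
    intro h0
    have := congrArg (fun q : ℂ[X] => q.coeff b) h0
    simp [hp, coeff_X_pow, h] at this
  refine ((p.roots.toFinset.finite_toSet).preimage Circle.coe_injective.injOn).subset fun u hu => ?_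
  have hu' : (x : ℂ) * (u : ℂ) ^ b = y * (u : ℂ) ^ b' := by
    exact_mod_cast congrArg (fun v : Circle => (v : ℂ)) hu
  rw [Set.mem_preimage, Finset.mem_coe, Multiset.mem_toFinset, mem_roots hp0]
  simp [hp, hu']

theorem finite_resonantSet {J : Type*} [Fintype J] (z : J → Circle) (N : ℕ) :
    (resonantSet z N).Finite := by
  have : resonantSet z N ⊆ ⋃ (a : J → Fin (N + 1)) (a' : J → Fin (N + 1))
      (b : Fin (N + 1)) (b' : {b' : Fin (N + 1) // b ≠ b'}),
      {u | (∏ i, z i ^ (a i : ℕ)) * u ^ (b : ℕ) = (∏ i, z i ^ (a' i : ℕ)) * u ^ (b' : ℕ)} := by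
    rintro u ⟨a, a', b, b', hb, h⟩
    simp only [Set.mem_iUnion]
    exact ⟨a, a', b, ⟨b', hb⟩, h⟩
  classical
  refine (Set.finite_iUnion fun a => Set.finite_iUnion fun a' => Set.finite_iUnion fun b =>
    Set.finite_iUnion fun b' => Circle.finite_setOf_mul_pow_eq _ _ ?_).subset this
  exact fun h => b'.2 (Fin.ext h)

theorem injective_prod_pow_of_notMem_resonantSet {J : Type*} [Fintype J] {z : J → Circle}
    (hz : Function.Injective fun a : J → ℕ => ∏ i, z i ^ a i) {N : ℕ} {u : Circle}
    (hu : u ∉ resonantSet z N) :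
    Function.Injective fun a : Option J → Fin (N + 1) => ∏ j, (j.elim u z) ^ (a j : ℕ) := by
  intro a a' h
  simp only [Fintype.prod_option, Option.elim] at h
  have hb : a none = a' none := by
    by_contra hb
    exact hu ⟨fun i => a (some i), fun i => a' (some i), a none, a' none, hb, by
      rw [mul_comm, h, mul_comm]⟩
  rw [hb] at h
  have hJ := hz (mul_left_cancel h)
  ext j
  cases j with
  | none => rw [hb]
  | some i => exact congrFun hJ i

/-- The times at which the first `k` coordinates of the orbit of `z` are within `1 / (k + 1)`
of the identity. -/
def returnTimes (z : ℕ → Circle) (k : ℕ) : Set ℕ :=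
  {m | ∀ i < k, dist (z i ^ m) 1 < 1 / ((k : ℝ) + 1)}

theorem antitone_returnTimes (z : ℕ → Circle) : Antitone (returnTimes z) := by
  intro k l hkl m hm i hi
  exact (hm i (hi.trans_le hkl)).trans_le (one_div_le_one_div_of_le (by positivity) (by gcongr))

theorem exists_degree_returnTimes {z : ℕ → Circle} (k : ℕ)
    (hz : Function.Injective fun a : Fin k → ℕ => ∏ i : Fin k, z i ^ a i) :
    ∃ N : ℕ, ∀ u ∉ resonantSet (fun i : Fin k => z i) N, ∀ (w : Circle) (M : ℕ),
      ∃ m ≥ M, m ∈ returnTimes z k ∧ dist (u ^ m) w < 1 / ((k : ℝ) + 1) := by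
  obtain ⟨N, hN⟩ := exists_degree_forall_dist_lt (Option (Fin k)) (ε := 1 / ((k : ℝ) + 1))
    (by positivity)
  refine ⟨N, fun u hu w M => ?_⟩
  obtain ⟨m, hm, h⟩ := hN (fun j => j.elim w fun _ => 1) (fun j => j.elim u fun i => z i)
    (injective_prod_pow_of_notMem_resonantSet hz hu) M
  exact ⟨m, hm, fun i hi => h (some ⟨i, hi⟩), h none⟩

theorem exists_block_s5 {K : Set Circle} (hK : IsCompact K) {T : Set ℕ} {ε : ℝ} {M : ℕ}
    (h : ∀ u ∈ K, ∀ w : Circle, ∃ m ≥ M, m ∈ T ∧ dist (u ^ m) w < ε) :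
    ∃ L, ∀ u ∈ K, ∀ w : Circle, ∃ m ∈ T, M ≤ m ∧ m < L ∧ dist (u ^ m) w < ε := by
  set U : ℕ → Set (Circle × Circle) := fun L =>
    {p | ∃ m ∈ T, M ≤ m ∧ m < L ∧ dist (p.1 ^ m) p.2 < ε} with hU
  have hopen : ∀ L, IsOpen (U L) := by
    intro L
    have : U L = ⋃ m ∈ {m | m ∈ T ∧ M ≤ m ∧ m < L}, {p | dist (p.1 ^ m) p.2 < ε} := by
      ext p
      simp only [hU, Set.mem_ofPred_eq, Set.mem_iUnion, exists_prop, and_assoc]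
    rw [this]
    exact isOpen_biUnion fun m _ => isOpen_lt (by fun_prop) continuous_const
  have hcover : K ×ˢ Set.univ ⊆ ⋃ L, U L := by
    rintro ⟨u, w⟩ ⟨hu, -⟩
    obtain ⟨m, hm, hT, hd⟩ := h u hu w
    exact Set.mem_iUnion.2 ⟨m + 1, m, hT, hm, m.lt_succ_self, hd⟩
  have hmono : Monotone U := by
    rintro L L' hL p ⟨m, hT, hm, hmL, hd⟩
    exact ⟨m, hT, hm, hmL.trans_le hL, hd⟩
  obtain ⟨L, hL⟩ := (hK.prod isCompact_univ).elim_directed_cover U hopen hcover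
    hmono.directed_le
  exact ⟨L, fun u hu w => hL (Set.mk_mem_prod hu (Set.mem_univ w))⟩

theorem Set.Finite.exists_separation {X : Type*} [MetricSpace X] {s : Set X} (hs : s.Finite) :
    ∃ δ > 0, ∀ x ∈ s, ∀ y ∈ s, dist x y < δ → x = y := by
  have : ∃ δ > 0, ∀ p ∈ hs.toFinset ×ˢ hs.toFinset, p.1 ≠ p.2 → δ ≤ dist p.1 p.2 := by
    classical
    induction hs.toFinset ×ˢ hs.toFinset using Finset.induction with
    | empty => exact ⟨1, one_pos, by simp⟩
    | insert p t _ ih =>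
      obtain ⟨δ, hδ, h⟩ := ih
      by_cases hp : p.1 = p.2
      · refine ⟨δ, hδ, fun q hq hne => ?_⟩
        rcases Finset.mem_insert.1 hq with rfl | hq
        · exact absurd hp hne
        · exact h q hq hne
      · refine ⟨min δ (dist p.1 p.2), lt_min hδ (dist_pos.2 hp), fun q hq hne => ?_⟩
        rcases Finset.mem_insert.1 hq with rfl | hq
        · exact min_le_right _ _
        · exact (min_le_left _ _).trans (h q hq hne)
  obtain ⟨δ, hδ, h⟩ := this
  refine ⟨δ, hδ, fun x hx y hy hxy => ?_⟩
  by_contra hne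
  exact (h (x, y) (by simp [hx, hy]) hne).not_gt hxy

/-- An increasing union of finite sets is the lower limit of suitable neighbourhoods of them. -/
theorem exists_radii {X : Type*} [MetricSpace X] {F : ℕ → Set X} (hF : ∀ k, (F k).Finite)
    (hmono : Monotone F) :
    ∃ ρ : ℕ → ℝ, (∀ k, 0 < ρ k) ∧
      ∀ x ∉ ⋃ k, F k, ∃ᶠ k in atTop, ∀ f ∈ F k, ρ k ≤ dist x f := by
  choose δ hδ hsep using fun k => (hF k).exists_separation
  refine ⟨fun k => min (min (δ k) (δ (k + 1))) (1 / ((k : ℝ) + 1)) / 2, fun k => ?_, fun x hx => ?_⟩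
  · have := hδ k
    have := hδ (k + 1)
    positivity
  intro hev
  simp only [not_forall, not_le] at hev
  obtain ⟨K, hK⟩ := eventually_atTop.1 hev
  choose f hfF hf using hK
  have hconst : ∀ k (hk : K ≤ k), f (k + 1) (hk.trans k.le_succ) = f k hk := by
    intro k hk
    refine hsep (k + 1) _ (hfF _ _) _ (hmono k.le_succ (hfF _ _)) ?_
    have h1 := hf (k + 1) (hk.trans k.le_succ)
    have h2 := hf k hk
    have h3 : min (min (δ (k + 1)) (δ (k + 1 + 1))) (1 / (((k + 1 : ℕ) : ℝ) + 1)) ≤ δ (k + 1) :=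
      (min_le_left _ _).trans (min_le_left _ _)
    have h4 : min (min (δ k) (δ (k + 1))) (1 / ((k : ℝ) + 1)) ≤ δ (k + 1) :=
      (min_le_left _ _).trans (min_le_right _ _)
    have := dist_triangle_left (f (k + 1) (hk.trans k.le_succ)) (f k hk) x
    linarith
  have hall : ∀ k (hk : K ≤ k), f k hk = f K le_rfl := by
    intro k hk
    induction k, hk using Nat.le_induction with
    | base => rfl
    | succ k hk ih => rw [hconst k hk, ih]
  refine hx (Set.mem_iUnion.2 ⟨K, ?_⟩)
  have hdist : dist x (f K le_rfl) ≤ 0 := by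
    refine ge_of_tendsto (tendsto_one_div_add_atTop_nhds_zero_nat (𝕜 := ℝ)) ?_
    filter_upwards [eventually_ge_atTop K] with k hk
    have h1 := hf k hk
    rw [hall k hk] at h1
    have h2 : min (min (δ k) (δ (k + 1))) (1 / ((k : ℝ) + 1)) ≤ 1 / ((k : ℝ) + 1) :=
      min_le_right _ _
    have h3 : 0 < 1 / ((k : ℝ) + 1) := by positivity
    linarith
  rw [dist_le_zero.1 hdist]
  exact hfF _ _

instance : Infinite Circle := by
  have h : (Metric.sphere (0 : ℂ) 1).Infinite :=
    (isPreconnected_sphere (by simp [Complex.rank_real_complex]) 0 1).infinite_of_nontrivial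
      ⟨1, by simp, -1, by simp, by norm_num⟩
  exact h.to_subtype

theorem exists_infinite_dense_orbits {T : ℕ → Set ℕ} (hT : Antitone T) {F : ℕ → Set Circle}
    (hF : ∀ k, (F k).Finite) (hmono : Monotone F)
    (h : ∀ k, ∀ u ∉ F k, ∀ (w : Circle) (M : ℕ),
      ∃ m ≥ M, m ∈ T k ∧ dist (u ^ m) w < 1 / ((k : ℝ) + 1)) :
    ∃ S : Set ℕ, S.Infinite ∧ (∀ k, ∃ M, ∀ m ∈ S, M ≤ m → m ∈ T k) ∧
      ∀ u ∉ ⋃ k, F k, ∀ w : Circle, ∀ ε > 0, ∃ m ∈ S, dist (u ^ m) w < ε := by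
  obtain ⟨ρ, hρ, hfreq⟩ := exists_radii hF hmono
  have hblock : ∀ k M, ∃ L, M < L ∧ (∃ m ∈ T k, M ≤ m ∧ m < L) ∧
      ∀ u : Circle, (∀ f ∈ F k, ρ k ≤ dist u f) → ∀ w : Circle,
        ∃ m ∈ T k, M ≤ m ∧ m < L ∧ dist (u ^ m) w < 1 / ((k : ℝ) + 1) := by
    intro k M
    have hK : IsCompact {u : Circle | ∀ f ∈ F k, ρ k ≤ dist u f} := by
      refine IsClosed.isCompact ?_
      simp only [Set.ofPred_forall]
      exact isClosed_biInter fun f _ => isClosed_le continuous_const (by fun_prop)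
    obtain ⟨L, hL⟩ := exists_block_s5 hK fun u hu w => h k u
      (fun hmem => ((hu u hmem).trans_eq (dist_self u)).not_gt (hρ k)) w M
    obtain ⟨v, hv⟩ := (hF k).infinite_compl.nonempty
    obtain ⟨m, hm, hmT, -⟩ := h k v hv 1 M
    refine ⟨max L (m + 1), by omega, ⟨m, hmT, hm, by omega⟩, fun u hu w => ?_⟩
    obtain ⟨m', h1, h2, h3, h4⟩ := hL u hu w
    exact ⟨m', h1, h2, by omega, h4⟩
  choose L hlt hne hL using hblock
  set M : ℕ → ℕ := fun k => Nat.rec 0 L k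
  have hMmono : StrictMono M := strictMono_nat_of_lt_succ fun k => hlt k (M k)
  refine ⟨{m | ∃ k, m ∈ T k ∧ M k ≤ m ∧ m < M (k + 1)}, ?_, fun k => ⟨M k, ?_⟩, ?_⟩
  · refine Set.infinite_of_not_bddAbove ?_
    rintro ⟨B, hB⟩
    obtain ⟨m, hm, h1, h2⟩ := hne (B + 1) (M (B + 1))
    have := hB ⟨B + 1, hm, h1, h2⟩
    have := hMmono.le_apply (x := B + 1)
    omega
  · rintro m ⟨l, hm, -, h2⟩ hkm
    refine hT ?_ hm
    have : k < l + 1 := hMmono.lt_iff_lt.1 (hkm.trans_lt h2)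
    omega
  · intro u hu w ε hε
    obtain ⟨k, hk, hkε⟩ := ((hfreq u hu).and_eventually
      ((tendsto_one_div_add_atTop_nhds_zero_nat (𝕜 := ℝ)).eventually_lt_const hε)).exists
    obtain ⟨m, hm, h1, h2, hd⟩ := hL k (M k) u hk w
    exact ⟨m, ⟨k, hm, h1, h2⟩, hd.trans hkε⟩

theorem Circle.dist_div_one (u w : Circle) : dist (u / w) 1 = dist u w := by
  have h : ((u / w : Circle) : ℂ) - 1 = (u - w) / w := by
    rw [Circle.coe_div, sub_div, div_self w.coe_ne_zero]
  have h1 : dist (u / w) 1 = ‖((u / w : Circle) : ℂ) - 1‖ :=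
    dist_eq_norm ((u / w : Circle) : ℂ) (1 : ℂ)
  rw [h1, h, norm_div, Circle.norm_coe, div_one]
  exact (dist_eq_norm (u : ℂ) (w : ℂ)).symm

theorem Real.fourierChar_eq_iff {x y : ℝ} :
    Real.fourierChar x = Real.fourierChar y ↔ ∃ n : ℤ, x = y + n := by
  rw [Real.fourierChar_apply', Real.fourierChar_apply', Circle.exp_eq_exp]
  refine exists_congr fun n => ⟨fun h => ?_, fun h => by rw [h]; ring⟩
  exact mul_left_cancel₀ Real.two_pi_pos.ne' (h.trans (by ring))

theorem Real.fourierChar_natCast_mul (n : ℕ) (x : ℝ) :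
    Real.fourierChar (n * x) = Real.fourierChar x ^ n := by
  rw [← nsmul_eq_mul, AddChar.map_nsmul_eq_pow]

theorem prod_fourierChar_pow {J : Type*} [Fintype J] (β : J → ℝ) (a : J → ℕ) :
    ∏ i, Real.fourierChar (β i) ^ a i = Real.fourierChar (∑ i, a i * β i) := by
  classical
  induction (Finset.univ : Finset J) using Finset.induction with
  | empty => simp
  | insert i t hi ih =>
    rw [Finset.prod_insert hi, Finset.sum_insert hi, AddChar.map_add_eq_mul, ih,
      Real.fourierChar_natCast_mul]

theorem distToInt_le_dist_fourierChar (x : ℝ) : distToInt x ≤ dist (Real.fourierChar x) 1 := by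
  set r : ℝ := x - round x with hr
  have hr2 : |r| ≤ 1 / 2 := abs_sub_round x
  have hx : Real.fourierChar x = Real.fourierChar r :=
    Real.fourierChar_eq_iff.2 ⟨round x, by rw [hr]; ring⟩
  have hdist : dist (Real.fourierChar r) 1 = ‖(Real.fourierChar r : ℂ) - 1‖ :=
    dist_eq_norm (Real.fourierChar r : ℂ) (1 : ℂ)
  rw [hx, hdist, Real.fourierChar_apply, mul_comm, Complex.norm_exp_I_mul_ofReal_sub_one,
    Real.norm_eq_abs, abs_mul, abs_two, show 2 * Real.pi * r / 2 = Real.pi * r by ring]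
  have hpi := Real.pi_pos
  have h := Real.mul_abs_le_abs_sin (x := Real.pi * r) (by
    rw [abs_mul, abs_of_pos hpi]
    nlinarith)
  rw [abs_mul, abs_of_pos hpi, ← mul_assoc, div_mul_cancel₀ _ hpi.ne'] at h
  have : distToInt x = |r| := rfl
  linarith [abs_nonneg r]

theorem injective_prod_fourierChar_pow {α : ℕ → ℝ}
    (hα : LinearIndependent ℚ (fun o : Option ℕ => o.elim (1 : ℝ) α)) (k : ℕ) :
    Function.Injective fun a : Fin k → ℕ => ∏ i : Fin k, Real.fourierChar (α i) ^ a i := by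
  intro a a' h
  simp only [prod_fourierChar_pow (fun i : Fin k => α i)] at h
  obtain ⟨n, hn⟩ := Real.fourierChar_eq_iff.1 h
  have hα' := hα.comp (Option.map ((↑) : Fin k → ℕ)) (Option.map_injective Fin.val_injective)
  have h0 := Fintype.linearIndependent_iff.1 hα'
    (fun o => o.elim (-(n : ℚ)) fun i => (a i : ℚ) - a' i) (by
      simp only [Fintype.sum_option, Function.comp, Option.map, Option.elim, Rat.smul_def]
      push_cast
      simp only [sub_mul, Finset.sum_sub_distrib, hn]
      ring)
  funext i
  have := h0 (some i)
  simp only [Option.elim, sub_eq_zero] at this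
  exact_mod_cast this

theorem mem_span_of_fourierChar_mem_resonantSet {α : ℕ → ℝ} {k N : ℕ} {θ : ℝ}
    (h : Real.fourierChar θ ∈ resonantSet (fun i : Fin k => Real.fourierChar (α i)) N) :
    θ ∈ Submodule.span ℚ (insert (1 : ℝ) (Set.range α)) := by
  obtain ⟨a, a', b, b', hb, h⟩ := h
  rw [prod_fourierChar_pow, prod_fourierChar_pow, ← Real.fourierChar_natCast_mul,
    ← Real.fourierChar_natCast_mul, ← AddChar.map_add_eq_mul, ← AddChar.map_add_eq_mul,
    Real.fourierChar_eq_iff] at h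
  obtain ⟨n, hn⟩ := h
  set V : Submodule ℚ ℝ := Submodule.span ℚ (insert (1 : ℝ) (Set.range α))
  have h1 : (1 : ℝ) ∈ V := Submodule.subset_span (Set.mem_insert _ _)
  have hα : ∀ i, α i ∈ V := fun i =>
    Submodule.subset_span (Set.mem_insert_of_mem _ (Set.mem_range_self i))
  have hsum : ∀ c : Fin k → Fin (N + 1), ∑ i, ((c i : ℕ) : ℝ) * α i ∈ V := fun c =>
    sum_mem fun i _ => by
      rw [← nsmul_eq_mul]
      exact nsmul_mem (hα i) _
  have hint : (n : ℝ) ∈ V := by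
    rw [← zsmul_one]
    exact zsmul_mem h1 _
  have hq : ((b : ℕ) : ℚ) - ((b' : ℕ) : ℚ) ≠ 0 := by
    rw [sub_ne_zero]
    exact_mod_cast fun h => hb (Fin.ext h)
  rw [← V.smul_mem_iff hq]
  convert sub_mem (add_mem (hsum a') hint) (hsum a) using 1
  rw [Rat.smul_def]
  push_cast
  linarith

theorem exists_tendsto_fourierChar_of_mem_span {α : ℕ → ℝ} {s : ℕ → ℕ}
    (hs : ∀ i, Tendsto (fun n => Real.fourierChar (s n * α i)) atTop (nhds 1)) {θ : ℝ}
    (hθ : θ ∈ Submodule.span ℚ (insert (1 : ℝ) (Set.range α))) :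
    ∃ Q : ℕ, 0 < Q ∧ Tendsto (fun n => Real.fourierChar (s n * (Q * θ))) atTop (nhds 1) := by
  induction hθ using Submodule.span_induction with
  | mem x hx =>
    refine ⟨1, one_pos, ?_⟩
    rcases hx with rfl | ⟨i, rfl⟩
    · refine tendsto_const_nhds.congr fun n => ?_
      rw [← AddChar.map_zero_eq_one Real.fourierChar, eq_comm, Real.fourierChar_eq_iff]
      exact ⟨s n, by simp⟩
    · simpa using hs i
  | zero => exact ⟨1, one_pos, by simp⟩
  | add x y _ _ hx hy =>
    obtain ⟨Q, hQ, hx⟩ := hx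
    obtain ⟨R, hR, hy⟩ := hy
    refine ⟨Q * R, by positivity, ?_⟩
    have h := (hx.pow R).mul (hy.pow Q)
    simp only [one_pow, mul_one, ← Real.fourierChar_natCast_mul, ← AddChar.map_add_eq_mul] at h
    refine h.congr fun n => congrArg _ ?_
    push_cast
    ring
  | smul q x _ hx =>
    obtain ⟨Q, hQ, hx⟩ := hx
    refine ⟨Q * q.den, Nat.mul_pos hQ q.den_pos, ?_⟩
    have h := hx.zpow q.num
    simp only [one_zpow, ← AddChar.map_zsmul_eq_zpow, zsmul_eq_mul] at h
    refine h.congr fun n => congrArg _ ?_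
    have hq : (q : ℝ) * q.den = q.num := by exact_mod_cast Rat.mul_den_eq_num q
    rw [Rat.smul_def, ← hq]
    push_cast
    ring

theorem not_Ico_subset_closure_range_fract {s : ℕ → ℕ} {θ : ℝ} {Q : ℕ} (hQ : 0 < Q)
    (h : Tendsto (fun n => Real.fourierChar (s n * (Q * θ))) atTop (nhds 1)) :
    ¬ Set.Ico (0 : ℝ) 1 ⊆ closure (Set.range fun n => Int.fract ((s n : ℝ) * θ)) := by
  intro hsub
  set C : Set Circle := insert 1 (Set.range fun n => Real.fourierChar (s n * (Q * θ)))
  set g : ℝ → Circle := fun x => Real.fourierChar (Q * x)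
  have hgc : Continuous g := Real.continuous_fourierChar.comp (continuous_const.mul continuous_id)
  have hCc : C.Countable := (Set.countable_range _).insert 1
  have hgC : closure (Set.range fun n => Int.fract ((s n : ℝ) * θ)) ⊆ g ⁻¹' C := by
    refine closure_minimal ?_ (h.isCompact_insert_range.isClosed.preimage hgc)
    rintro _ ⟨n, rfl⟩
    refine Or.inr ⟨n, Real.fourierChar_eq_iff.2 ⟨Q * ⌊(s n : ℝ) * θ⌋, ?_⟩⟩
    simp only [← Int.self_sub_floor]
    push_cast
    ring
  have hpre : IsPreconnected (g '' Set.Ico 0 1) :=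
    isPreconnected_Ico.image g hgc.continuousOn
  have hss := hCc.isTotallyDisconnected _ (Set.image_subset_iff.2 (hsub.trans hgC)) hpre
  have hQ' : (1 : ℝ) ≤ Q := by exact_mod_cast hQ
  have hmem : (1 / (2 * Q) : ℝ) ∈ Set.Ico (0 : ℝ) 1 := by
    refine ⟨by positivity, ?_⟩
    rw [div_lt_one (by positivity)]
    linarith
  have heq := hss (Set.mem_image_of_mem g (Set.left_mem_Ico.2 one_pos))
    (Set.mem_image_of_mem g hmem)
  obtain ⟨n, hn⟩ := Real.fourierChar_eq_iff.1 heq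
  have hn' : (2 : ℝ) * n = -1 := by
    field_simp at hn
    linarith
  have : (2 * n : ℤ) = -1 := by exact_mod_cast hn'
  omega

theorem Ico_subset_closure_range_fract_s5 {s : ℕ → ℕ} {θ : ℝ}
    (h : ∀ w : Circle, ∀ ε > 0, ∃ n, dist (Real.fourierChar θ ^ s n) w < ε) :
    Set.Ico (0 : ℝ) 1 ⊆ closure (Set.range fun n => Int.fract ((s n : ℝ) * θ)) := by
  have hIoo : Set.Ioo (0 : ℝ) 1 ⊆ closure (Set.range fun n => Int.fract ((s n : ℝ) * θ)) := by
    rintro c ⟨hc0, hc1⟩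
    rw [Metric.mem_closure_range_iff]
    intro ε hε
    obtain ⟨n, hn⟩ := h (Real.fourierChar c) (min ε (min c (1 - c)))
      (lt_min hε (lt_min hc0 (by linarith)))
    have hd : dist (Real.fourierChar (s n * θ - c)) 1
        = dist (Real.fourierChar θ ^ s n) (Real.fourierChar c) := by
      rw [← Real.fourierChar_natCast_mul]
      rw [AddChar.map_sub_eq_div, Circle.dist_div_one]
    have hlt := (distToInt_le_dist_fourierChar _).trans_lt (hd.trans_lt hn)
    rw [distToInt, lt_min_iff, lt_min_iff] at hlt
    obtain ⟨h1, h2, h3⟩ := hlt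
    have hfract : Int.fract (s n * θ) = s n * θ - round (s n * θ - c) := by
      rw [Int.fract_eq_iff]
      rw [abs_lt] at h2 h3
      exact ⟨by linarith, by linarith, round (s n * θ - c), by ring⟩
    refine ⟨n, ?_⟩
    rw [dist_comm, Real.dist_eq, hfract, sub_right_comm]
    exact h1
  refine subset_trans ?_ (closure_minimal hIoo isClosed_closure)
  rw [closure_Ioo (zero_ne_one' ℝ)]
  exact Set.Ico_subset_Icc_self

/-- If `{1, α_1, α_2, …}` is linearly independent over `ℚ` (with `α i` denoting `α_{i+1}`),
then there is a strictly increasing sequence of naturals `(s n)` with `‖s_n α_i‖ → 0` for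
every `i`, and such that for every real `θ`, the sequence of fractional parts
`(s_n θ [1])` is dense in `[0,1)` iff `θ` is not a finite `ℚ`-linear combination of
`1, α_1, α_2, …`, i.e. iff `θ ∉ ⋃_n (ℚ + ℚα_1 + ⋯ + ℚα_n)`. -/
theorem stmt5 (α : ℕ → ℝ)
    (hα : LinearIndependent ℚ (fun o : Option ℕ => o.elim (1:ℝ) α)) :
    ∃ s : ℕ → ℕ, StrictMono s ∧
      (∀ i : ℕ, Tendsto (fun n : ℕ => distToInt ((s n : ℝ) * α i)) atTop (nhds 0)) ∧
      (∀ θ : ℝ,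
        (Set.Ico (0:ℝ) 1 ⊆ closure (Set.range fun n : ℕ => Int.fract ((s n : ℝ) * θ))) ↔
        θ ∉ Submodule.span ℚ (insert (1:ℝ) (Set.range α))) := by
  set z : ℕ → Circle := fun i => Real.fourierChar (α i)
  choose N hN using fun k => exists_degree_returnTimes (z := z) k (injective_prod_fourierChar_pow hα k)
  set R : ℕ → Set Circle := fun k => resonantSet (fun i : Fin k => z i) (N k)
  obtain ⟨S, hS, hret, hdense⟩ := exists_infinite_dense_orbits (antitone_returnTimes z)
    (F := Set.accumulate R)
    (fun k => (Set.finite_Iic k).biUnion fun j _ => finite_resonantSet _ (N j))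
    Set.monotone_accumulate
    (fun k u hu => hN k u fun h => hu (Set.subset_accumulate h))
  have hinf : {m | m ∈ S}.Infinite := hS
  have hmem : ∀ n, Nat.nth (· ∈ S) n ∈ S := fun n => Nat.nth_mem_of_infinite hinf n
  have hmono := Nat.nth_strictMono hinf
  have htend : ∀ i, Tendsto (fun n => Real.fourierChar ((Nat.nth (· ∈ S) n : ℝ) * α i))
      atTop (nhds 1) := by
    intro i
    rw [Metric.tendsto_nhds]
    intro ε hε
    obtain ⟨k, hk, hik⟩ := (((tendsto_one_div_add_atTop_nhds_zero_nat
      (𝕜 := ℝ)).eventually_lt_const hε).and (eventually_gt_atTop i)).exists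
    obtain ⟨M, hM⟩ := hret k
    filter_upwards [eventually_ge_atTop M] with n hn
    rw [Real.fourierChar_natCast_mul]
    exact (hM _ (hmem n) (hn.trans hmono.le_apply) i hik).trans hk
  refine ⟨Nat.nth (· ∈ S), hmono, fun i => ?_, fun θ => ⟨fun h hθ => ?_, fun hθ => ?_⟩⟩
  · exact squeeze_zero (fun n => abs_nonneg _) (fun n => distToInt_le_dist_fourierChar _)
      (tendsto_iff_dist_tendsto_zero.1 (htend i))
  · obtain ⟨Q, hQ, hlim⟩ := exists_tendsto_fourierChar_of_mem_span htend hθ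
    exact not_Ico_subset_closure_range_fract hQ hlim h
  · refine Ico_subset_closure_range_fract_s5 fun w ε hε => ?_
    have hθR : Real.fourierChar θ ∉ ⋃ k, Set.accumulate R k := by
      rw [Set.iUnion_accumulate, Set.mem_iUnion]
      rintro ⟨k, hk⟩
      exact hθ (mem_span_of_fourierChar_mem_resonantSet hk)
    obtain ⟨m, hm, hd⟩ := hdense _ hθR w ε hε
    obtain ⟨n, rfl⟩ := (Nat.range_nth_of_infinite hinf).symm.subset hm
    exact ⟨n, hd⟩
end
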